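/- Let H be a finite group and d ∈ H an element of order 3 such that X = C_H(d) is isomorphic to the centralizer in PSp₄(3) of a non-trivial 3-central element. Let P be a Sylow 3-subgroup of X and E an elementary abelian subgroup of P of order 27. Assume that E does not normalize any non-trivial subgroup of H of order coprime to 3, that d is not H-conjugate to its inverse d⁻¹, and that H has a normal subgroup of index 3. Then H = C_H(d), i.e. d is central in H. -/

import Mathlib

/-- `P` is a Sylow `p`-subgroup of the subgroup `K` of `G`: `P` is a `p`-subgroup
contained in `K` which is maximal among the `p`-subgroups of `G` contained in `K`. -/
def IsSylowIn {G : Type*} [Group G] (p : ℕ) (P K : Subgroup G) : Prop :=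
  P ≤ K ∧ IsPGroup p P ∧ ∀ R : Subgroup G, R ≤ K → IsPGroup p R → P ≤ R → R = P

/-- the symplectic group `Sp₄(3)` of `4 × 4` symplectic matrices over `ℤ/3ℤ`. -/
abbrev Sp4F3 : Type := Matrix.symplecticGroup (Fin 2) (ZMod 3)

/-- the projective symplectic group `PSp₄(3)`, the quotient of `Sp₄(3)` by its centre. -/
abbrev PSp4F3 : Type := Sp4F3 ⧸ Subgroup.center Sp4F3

/-- an element of a group is `3`-central if it has order `3` and lies in the centre of
some Sylow `3`-subgroup. -/
def IsThreeCentral {H : Type*} [Group H] (z : H) : Prop :=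
  orderOf z = 3 ∧ ∃ T : Sylow 3 H, z ∈ (T : Subgroup H) ∧ ∀ t ∈ (T : Subgroup H), z * t = t * z

open Subgroup

/-- orbit-stabilizer for conjugation -/
theorem card_conj_mul {G : Type*} [Group G] [Finite G] (g : G) :
    Nat.card {x : G // IsConj g x} * Nat.card (centralizer {g} : Subgroup G) = Nat.card G := by
  rw [Subgroup.nat_card_centralizer_nat_card_stabilizer, ← Nat.card_congr (ConjAct.toConjAct (G := G)).toEquiv.symm]
  have := MulAction.index_stabilizer (ConjAct G) g
  rw [← Subgroup.index_mul_card (MulAction.stabilizer (ConjAct G) g), MulAction.index_stabilizer,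
   ConjAct.orbit_eq_carrier_conjClasses]
  congr 1

/-- transfer into an abelian subgroup, as an endomorphism -/
theorem exists_transfer {M : Type*} [Group M] [Finite M] (E : Subgroup M)
    (hc : ∀ x ∈ E, ∀ y ∈ E, x * y = y * x) :
    ∃ V : M →* M, (∀ g, V g ∈ E) ∧
      ∀ g, (∀ (k : ℕ) (h : M), h⁻¹ * g ^ k * h ∈ E → h⁻¹ * g ^ k * h = g ^ k) →
        V g = g ^ E.index := by
  let _ : CommGroup E := { (inferInstance : Group E) with
    mul_comm := fun x y => Subtype.ext (hc x x.2 y y.2) }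
  refine ⟨E.subtype.comp (MonoidHom.transfer (MonoidHom.id E)), fun g => ?_, fun g hg => ?_⟩
  · exact Subtype.prop _
  · rw [MonoidHom.comp_apply, MonoidHom.transfer_eq_pow _ g hg]; rfl

/-- Burnside normal complement theorem -/
theorem burnside3 {G : Type*} [Group G] [Finite G] (S : Subgroup G) (hS : IsPGroup 3 S)
    (hmax : ∀ R : Subgroup G, IsPGroup 3 R → S ≤ R → R ≤ S)
    (hN : ∀ g : G, (∀ s ∈ S, g * s * g⁻¹ ∈ S) → ∀ s ∈ S, g * s = s * g) :
    ∃ N : Subgroup G, N.Normal ∧ (Nat.card N).Coprime 3 ∧ ∀ g : G, ∃ n ∈ N, ∃ s ∈ S, g = n * s := by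
  have : Fact (Nat.Prime 3) := ⟨by norm_num⟩
  let P : Sylow 3 G := ⟨S, hS, fun {R} hR h => le_antisymm (hmax R hR h) h⟩
  have hP : normalizer (P : Set G) ≤ centralizer (P : Set G) := by
    intro g hg s hs
    have hg : g ∈ normalizer ((S : Subgroup G) : Set G) := hg
    rw [Subgroup.mem_normalizer_iff] at hg
    exact (hN g (fun s hs => (hg s).1 hs) s hs).symm
  refine ⟨(MonoidHom.transferSylow P hP).ker, inferInstance, ?_, ?_⟩
  · rw [Nat.coprime_comm, Nat.Prime.coprime_iff_not_dvd (by norm_num)]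
    exact MonoidHom.not_dvd_card_ker_transferSylow P hP
  · intro g
    have := (MonoidHom.ker_transferSylow_isComplement' P hP)
    obtain ⟨⟨n, s⟩, h⟩ := this.2 g
    exact ⟨n, n.2, s, s.2, h.symm⟩

/-- a `3`-element of a subgroup of order prime to three is trivial -/
theorem eq_one_of_coprime3 {G : Type*} [Group G] [Finite G] (W : Subgroup G)
    (hc : (Nat.card W).Coprime 3) (p : G) (hp : p ∈ W) (h : p ^ 3 = 1) : p = 1 := by
  have h1 : orderOf p ∣ 3 := orderOf_dvd_of_pow_eq_one h
  have h2 : orderOf p ∣ Nat.card W := by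
    have := orderOf_dvd_natCard (⟨p, hp⟩ : W)
    rwa [Subgroup.orderOf_mk] at this
  have := Nat.dvd_gcd h2 h1
  rw [hc] at this
  exact orderOf_eq_one_iff.1 (Nat.dvd_one.1 this)

theorem aux_inj {G : Type*} [Group G] (v v' x : G)
    (h : v⁻¹ * (x * v * x⁻¹) = v'⁻¹ * (x * v' * x⁻¹)) : v' * v⁻¹ * x = x * (v' * v⁻¹) := by
  calc v' * v⁻¹ * x = v' * (v⁻¹ * (x * v * x⁻¹)) * x * v⁻¹ := by group
    _ = _ := by rw [h]; group

/-- Core of step 4. -/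
theorem core4 {G : Type*} [Group G] [Finite G] (W : Subgroup G) (hW : W.Normal)
    (hc : (Nat.card W).Coprime 3) (d e : G) (hde : d * e = e * d) (hd : d ^ 3 = 1) (he : e ^ 3 = 1)
    (hf : ∀ i : ℕ, ∀ w ∈ W, w * (e * d ^ i) = (e * d ^ i) * w → w = 1) :
    ∀ w ∈ W, w * d = d * w := by
  have hC : Commute d e := hde
  have key : ∀ i : ℕ, ∀ w ∈ W, (w * (e * d ^ i)) ^ 3 = 1 := by
    intro i w hw
    set x := e * d ^ i with hx
    have hx3 : x ^ 3 = 1 := by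
      rw [hx, (hC.symm.pow_right i).mul_pow, he, ← pow_mul, mul_comm i, pow_mul, hd]; simp
    let f : W → W := fun v => ⟨(v : G)⁻¹ * (x * v * x⁻¹), W.mul_mem (W.inv_mem v.2) (hW.conj_mem _ v.2 x)⟩
    have hinj : Function.Injective f := by
      intro v v' h
      have h1 : (v : G)⁻¹ * (x * v * x⁻¹) = (v' : G)⁻¹ * (x * v' * x⁻¹) := congrArg Subtype.val h
      have h2 := hf i ((v' : G) * (v : G)⁻¹) (W.mul_mem v'.2 (W.inv_mem v.2)) (by
        rw [← hx]
        exact aux_inj _ _ _ h1)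
      apply Subtype.ext
      rw [mul_inv_eq_one] at h2
      exact h2.symm
    obtain ⟨v, hv⟩ := Finite.surjective_of_injective hinj ⟨w, hw⟩
    have hv' : (v : G)⁻¹ * (x * v * x⁻¹) = w := congrArg Subtype.val hv
    rw [← hv']
    generalize (v : G) = v'
    have : v'⁻¹ * (x * v' * x⁻¹) * x = v'⁻¹ * x * (v'⁻¹)⁻¹ := by group
    rw [this, conj_pow, hx3]; simp
  intro w hw
  set f : G →* G := (MulAut.conj d).toMonoidHom with hfdef
  have hfa : ∀ g, f g = d * g * d⁻¹ := fun g => by simp [hfdef]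
  have hd3 : d * d * d = 1 := by rw [← hd, pow_succ, pow_two]
  have hf3 : ∀ g, f (f (f g)) = g := by
    intro g
    rw [hfa, hfa, hfa]
    calc _ = (d * d * d) * g * (d * d * d)⁻¹ := by group
      _ = g := by rw [hd3]; simp
  have key2 : ∀ i : ℕ, w * ((e * d ^ i) * w * (e * d ^ i)⁻¹) *
      ((e * d ^ i) * (e * d ^ i) * w * (e * d ^ i)⁻¹ * (e * d ^ i)⁻¹) = 1 := by
    intro i
    have h1 := key i w hw
    have h2 := key i 1 W.one_mem
    rw [one_mul] at h2
    generalize e * d ^ i = x at h1 h2 ⊢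
    calc _ = (w * x) ^ 3 * (x ^ 3)⁻¹ := by rw [pow_succ, pow_two]; group
      _ = 1 := by rw [h1, h2]; simp
  set U := e * w * e⁻¹ with hU
  set V := e * e * w * e⁻¹ * e⁻¹ with hV
  have hUW : U ∈ W := hW.conj_mem _ hw e
  have k0 : w * U * V = 1 := by simpa using key2 0
  have hed : e * d = d * e := hde.symm
  have k1 : w * f U * f (f V) = 1 := by
    rw [← key2 1, pow_one, hed, hfa, hfa, hfa, hU, hV]
    have : d * e * (d * e) = d * d * e * e := by
      rw [mul_assoc d e, ← mul_assoc e d, hed]; group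
    rw [this]
    have : (d * e)⁻¹ * (d * e)⁻¹ = e⁻¹ * e⁻¹ * d⁻¹ * d⁻¹ := by
      rw [← mul_inv_rev, this]; group
    rw [mul_assoc _ (d * e)⁻¹, this]
    group
  have k2 : w * f (f U) * f V = 1 := by
    have hC2 : e * (d * d) = d * d * e := by
      rw [← mul_assoc, hed, mul_assoc, hed]; group
    rw [← key2 2, pow_two, hC2, hfa, hfa, hfa, hU, hV]
    have : d * d * e * (d * d * e) = d * e * e := by
      calc _ = d * d * (e * (d * d)) * e := by group
        _ = d * d * d * d * e * e := by rw [hC2]; group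
        _ = _ := by rw [hd3, one_mul]
    rw [this]
    have : (d * d * e)⁻¹ * (d * d * e)⁻¹ = e⁻¹ * e⁻¹ * d⁻¹ := by
      rw [← mul_inv_rev, this]; group
    rw [mul_assoc _ (d * d * e)⁻¹, this]
    group
  have q1 : U * V = f U * f (f V) := by
    rw [mul_assoc] at k0 k1
    exact mul_left_cancel (k0.trans k1.symm)
  have q2 : U * V = f (f U) * f V := by
    rw [mul_assoc] at k0 k2
    exact mul_left_cancel (k0.trans k2.symm)
  have q3 : f U * f V = U * f (f V) := by
    have := congrArg f q2
    simpa [map_mul, hf3] using this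
  have q4 : U * f V = f U * V := by
    have := congrArg (fun g => f (f g)) q1
    have h' := congrArg (fun g => f (f g)) q2
    simp only [map_mul, hf3] at this h'
    rw [← this, h']
  have p1 : (f U)⁻¹ * U = f (f V) * V⁻¹ := by
    rw [eq_mul_inv_iff_mul_eq, mul_assoc, q1]; group
  have p2 : (f U)⁻¹ * U = f V * (f (f V))⁻¹ := by
    rw [eq_mul_inv_iff_mul_eq, mul_assoc, ← q3]; group
  have p3 : (f U)⁻¹ * U = V * (f V)⁻¹ := by
    rw [eq_mul_inv_iff_mul_eq, mul_assoc, q4]; group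
  have pW : (f U)⁻¹ * U ∈ W := W.mul_mem (W.inv_mem (by rw [hfa]; exact hW.conj_mem _ hUW d)) hUW
  have pp : ((f U)⁻¹ * U) ^ 3 = 1 := by
    calc ((f U)⁻¹ * U) ^ 3 = ((f U)⁻¹ * U) * ((f U)⁻¹ * U) * ((f U)⁻¹ * U) := by
          rw [pow_succ, pow_two]
      _ = (V * (f V)⁻¹) * (f V * (f (f V))⁻¹) * (f (f V) * V⁻¹) := by
          rw [← p3, ← p2, ← p1]
      _ = 1 := by group
  have po : (f U)⁻¹ * U = 1 := eq_one_of_coprime3 W hc _ pW pp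
  have fU : f U = U := by
    rw [inv_mul_eq_one] at po; exact po
  have h5 : d * U = U * d := by
    rw [hfa] at fU
    exact mul_inv_eq_iff_eq_mul.1 fU
  have h6 : e * (d * w) * e⁻¹ = e * (w * d) * e⁻¹ := by
    have hde' : d * e⁻¹ = e⁻¹ * d := (hC.inv_right).eq
    calc e * (d * w) * e⁻¹ = (e * d) * w * e⁻¹ := by group
      _ = d * U := by rw [hed, hU]; group
      _ = U * d := h5
      _ = e * w * (e⁻¹ * d) := by rw [hU]; group
      _ = _ := by rw [← hde']; group
  exact (mul_left_cancel (mul_right_cancel h6)).symm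

/-- commuting with a power prime to three of an element of exponent three -/
theorem comm_of_pow3 {M : Type*} [Group M] (a g : M) (ha : a ^ 3 = 1) (i : ℕ) (hi : ¬ 3 ∣ i)
    (h : g * a ^ i = a ^ i * g) : g * a = a * g := by
  have h1 : a ^ (i * i) = a := by
    have h2 : i * i % 3 = 1 := by
      have : i % 3 = 1 ∨ i % 3 = 2 := by omega
      rcases this with h | h <;> simp [Nat.mul_mod, h]
    rw [← Nat.div_add_mod (i * i) 3, h2, pow_add, pow_mul, ha]; simp
  have h3 : Commute g (a ^ i) := h
  have := h3.pow_right i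
  rw [← pow_mul, h1] at this
  exact this

theorem pow_eq_of_mod3 {M : Type*} [Group M] (a : M) (ha : a ^ 3 = 1) (i j : ℕ)
    (h : i % 3 = j % 3) : a ^ i = a ^ j := by
  rw [← Nat.div_add_mod i 3, ← Nat.div_add_mod j 3, h, pow_add, pow_mul, ha, pow_add, pow_mul, ha]
  simp

/-- The algebraic identity behind step 3. -/
theorem step3_alg {M : Type*} [Group M] (x a : M) (ha : a ^ 3 = 1) (hx : x ^ 3 = 1)
    (hxa : (x * a) ^ 3 = 1) (n : ℕ) (h3 : ((x⁻¹ * a) ^ n) ^ 3 = 1) :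
    ∃ p2, a * (x⁻¹ * a) ^ n * a⁻¹ = p2 ∧ (x⁻¹ * a) ^ n * p2 = p2 * (x⁻¹ * a) ^ n ∧
      a * (((x⁻¹ * a) ^ n)⁻¹ * p2) = (((x⁻¹ * a) ^ n)⁻¹ * p2) * a := by
  set c1 := x⁻¹ * a with hc1
  have haa : a * a * a = 1 := by rw [← ha, pow_succ, pow_two]
  have hxx : x * x * x = 1 := by rw [← hx, pow_succ, pow_two]
  have hxaa : x * a * x * a * x * a = 1 := by rw [← hxa, pow_succ, pow_two]; group
  have hx2 : x⁻¹ * x⁻¹ = x := by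
    calc x⁻¹ * x⁻¹ = x⁻¹ * x⁻¹ * (x * x * x) := by rw [hxx, mul_one]
      _ = x := by group
  have e2 : a * c1 * a⁻¹ = a * x⁻¹ := by rw [hc1]; group
  have e3 : a * (a * x⁻¹) * a⁻¹ = x * a * x := by
    calc a * (a * x⁻¹) * a⁻¹ = (a * a * a) * (a⁻¹ * x⁻¹ * a⁻¹) := by group
      _ = a⁻¹ * x⁻¹ * a⁻¹ := by rw [haa, one_mul]
      _ = (x * a * x * a * x * a) * (a⁻¹ * x⁻¹ * a⁻¹) := by rw [hxaa, one_mul]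
      _ = _ := by group
  have f1 : c1 * (a * x⁻¹) * (x * a * x) = 1 := by
    calc _ = x⁻¹ * (a * a * a) * x := by rw [hc1]; group
      _ = 1 := by rw [haa]; group
  have f2 : (x * a * x) * (a * x⁻¹) * c1 = 1 := by
    calc _ = x * a * x * a * (x⁻¹ * x⁻¹) * a := by rw [hc1]; group
      _ = 1 := by rw [hx2, hxaa]
  have g1 : x * a * x = (c1 * (a * x⁻¹))⁻¹ := eq_inv_of_mul_eq_one_right f1
  have g2 : x * a * x = ((a * x⁻¹) * c1)⁻¹ := by
    rw [mul_assoc] at f2; exact eq_inv_of_mul_eq_one_left f2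
  have hcom : Commute c1 (a * x⁻¹) := by
    have := g1.symm.trans g2
    exact inv_injective this
  refine ⟨(a * x⁻¹) ^ n, ?_, (hcom.pow_pow n n).eq, ?_⟩
  · rw [← conj_pow, e2]
  have k2 : a * c1 ^ n * a⁻¹ = (a * x⁻¹) ^ n := by rw [← conj_pow, e2]
  have k3 : a * (a * x⁻¹) ^ n * a⁻¹ = (c1 ^ n)⁻¹ * ((a * x⁻¹) ^ n)⁻¹ := by
    rw [← conj_pow, e3, g1, inv_pow, hcom.mul_pow, (hcom.pow_pow n n).eq, mul_inv_rev]
  have hp2 : ((a * x⁻¹) ^ n) ^ 3 = 1 := by rw [← k2, conj_pow, h3]; simp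
  have hcc := hcom.pow_pow n n
  generalize (a * x⁻¹) ^ n = p2 at *
  generalize c1 ^ n = p1 at *
  have hp2' : p2 * p2 * p2 = 1 := by rw [← hp2, pow_succ, pow_two]
  have hp2i : p2⁻¹ * p2⁻¹ = p2 := by
    calc p2⁻¹ * p2⁻¹ = p2⁻¹ * p2⁻¹ * (p2 * p2 * p2) := by rw [hp2', mul_one]
      _ = p2 := by group
  have : a * (p1⁻¹ * p2) * a⁻¹ = p1⁻¹ * p2 := by
    calc a * (p1⁻¹ * p2) * a⁻¹ = (a * p1 * a⁻¹)⁻¹ * (a * p2 * a⁻¹) := by group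
      _ = p2⁻¹ * p1⁻¹ * p2⁻¹ := by rw [k2, k3]; group
      _ = p1⁻¹ * (p2⁻¹ * p2⁻¹) := by rw [(hcc.inv_inv).symm.eq]; group
      _ = _ := by rw [hp2i]
  exact mul_inv_eq_iff_eq_mul.1 this

/-- Every `3`-subgroup is conjugate into a given Sylow subgroup. -/
theorem conj_into_sylow {G : Type*} [Group G] [Finite G] (T : Sylow 3 G) (R : Subgroup G)
    (hR : IsPGroup 3 R) : ∃ g : G, ∀ r ∈ R, g * r * g⁻¹ ∈ (T : Subgroup G) := by
  have : Fact (Nat.Prime 3) := ⟨by norm_num⟩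
  obtain ⟨Q, hQ⟩ := hR.exists_le_sylow
  obtain ⟨g, hg⟩ := MulAction.exists_smul_eq G Q T
  refine ⟨g, fun r hr => ?_⟩
  rw [← hg]
  have : r ∈ (Q : Subgroup G) := hQ hr
  have h2 := Subgroup.smul_mem_pointwise_smul r (MulAut.conj g) (Q : Subgroup G) this
  rw [Sylow.coe_subgroup_smul]
  simpa using h2

theorem isPGroup_zpowers3 {G : Type*} [Group G] (x : G) (n : ℕ) (hx : x ^ 3 ^ n = 1) :
    IsPGroup 3 (zpowers x) := by
  rintro ⟨y, hy⟩
  obtain ⟨k, rfl⟩ := mem_zpowers_iff.1 hy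
  refine ⟨n, Subtype.ext ?_⟩
  change (x ^ k) ^ 3 ^ n = 1
  rw [← zpow_natCast, ← zpow_mul, mul_comm, zpow_mul, zpow_natCast, hx, one_zpow]

/-- If the order-3 element `d` is the only conjugate of itself commuting with it, its class has
size `1` mod `3`. -/
theorem class_mod3 {G : Type*} [Group G] [Finite G] (d : G) (hd : d ^ 3 = 1)
    (hiso : ∀ g : G, (g * d * g⁻¹) * d = d * (g * d * g⁻¹) → g * d * g⁻¹ = d) :
    Nat.card {x : G // IsConj d x} % 3 = 1 := by
  classical
  have : Fact (Nat.Prime 3) := ⟨by norm_num⟩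
  let _ : Fintype {x : G // IsConj d x} := Fintype.ofFinite _
  have hd3 : d * d * d = 1 := by rw [← hd, pow_succ, pow_two]
  let f : Function.End {x : G // IsConj d x} := fun x =>
    ⟨d * x * d⁻¹, x.2.trans (isConj_iff.2 ⟨d, rfl⟩)⟩
  have hf : f ^ 3 ^ 1 = 1 := by
    funext x
    apply Subtype.ext
    change d * (d * (d * x * d⁻¹) * d⁻¹) * d⁻¹ = x
    generalize (x : G) = y
    calc _ = (d * d * d) * y * (d * d * d)⁻¹ := by group
      _ = y := by rw [hd3]; simp
  have h := Equiv.Perm.card_fixedPoints_modEq hf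
  have h1 : Fintype.card (Function.fixedPoints f) = 1 := by
    rw [Fintype.card_eq_one_iff]
    refine ⟨⟨⟨d, IsConj.refl d⟩, ?_⟩, ?_⟩
    · apply Subtype.ext
      change d * d * d⁻¹ = d
      group
    · rintro ⟨⟨x, hx⟩, hfx⟩
      have h2 : d * x * d⁻¹ = x := congrArg Subtype.val hfx
      obtain ⟨g, rfl⟩ := isConj_iff.1 hx
      apply Subtype.ext; apply Subtype.ext
      exact hiso g (mul_inv_eq_iff_eq_mul.1 h2).symm
  rw [h1] at h
  rw [Nat.card_eq_fintype_card]
  exact h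

theorem step3 {M : Type*} [Group M] [Finite M] (E : Subgroup M) (a d e z : M)
    (hE : ∀ x, x ∈ E ↔ ∃ i j k : ℕ, x = a ^ i * d ^ j * e ^ k)
    (hE27 : Nat.card E = 27)
    (ha3 : a ^ 3 = 1) (hd3 : d ^ 3 = 1) (he3 : e ^ 3 = 1)
    (had : Commute a d)
    (hind : ∀ i j k : ℕ, a ^ i * d ^ j * e ^ k = 1 → 3 ∣ i ∧ 3 ∣ j ∧ 3 ∣ k)
    (he : ∀ g, Commute g e)
    (hiso : ∀ g, (g * d * g⁻¹) * d = d * (g * d * g⁻¹) → g * d * g⁻¹ = d)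
    (hz : z * a * z⁻¹ = a⁻¹)
    (hCa : ∀ g, g * a = a * g → g ∈ E)
    (hCad : ∀ i j : ℕ, ¬ 3 ∣ i → ∀ g, g * (a ^ i * d ^ j) = (a ^ i * d ^ j) * g → g * d = d * g)
    (hCd : Nat.card (centralizer {d} : Subgroup M) = 54)
    (hCd2 : ∀ x, x * d = d * x → x ^ 2 ∈ E) :
    ∀ g, g * d = d * g := by
  classical
  have : Fact (Nat.Prime 3) := ⟨by norm_num⟩
  have had' : ∀ i j, Commute (a ^ i) (d ^ j) := fun i j => had.pow_pow i j
  have hem : ∀ k g, Commute g (e ^ k) := fun k g => (he g).pow_right k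
  have hEc : ∀ x ∈ E, ∀ y ∈ E, x * y = y * x := by
    intro x hx y hy
    obtain ⟨i, j, k, rfl⟩ := (hE x).1 hx
    obtain ⟨i', j', k', rfl⟩ := (hE y).1 hy
    have h1 : Commute (a ^ i * d ^ j * e ^ k) (a ^ i' * d ^ j' * e ^ k') := by
      apply Commute.mul_right _ (hem _ _)
      apply Commute.mul_left _ (hem _ _).symm
      apply Commute.mul_right
      · exact Commute.mul_left ((Commute.refl a).pow_pow _ _) (had' _ _).symm
      · exact Commute.mul_left (had' _ _) ((Commute.refl d).pow_pow _ _)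
    exact h1
  have hE3 : ∀ x ∈ E, x ^ 3 = 1 := by
    intro x hx
    obtain ⟨i, j, k, rfl⟩ := (hE x).1 hx
    rw [(hem k _).mul_pow, (had' i j).mul_pow, ← pow_mul, ← pow_mul, ← pow_mul, mul_comm i,
      mul_comm j, mul_comm k, pow_mul, pow_mul, pow_mul, ha3, hd3, he3]
    simp
  have haE : a ∈ E := (hE a).2 ⟨1, 0, 0, by simp⟩
  have hdE : d ∈ E := (hE d).2 ⟨0, 1, 0, by simp⟩
  -- the class of d
  set Ω := Nat.card {x : M // IsConj d x} with hΩ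
  have hM : Ω * 54 = Nat.card M := by rw [← hCd]; exact card_conj_mul d
  have hΩ3 : Ω % 3 = 1 := class_mod3 d hd3 hiso
  have hidx : E.index = 2 * Ω := by
    have := E.index_mul_card
    rw [hE27] at this
    omega
  set n := E.index with hn
  have hn3 : ¬ 3 ∣ n := by omega
  -- Sylow
  have hpow : ∀ g : M, (g ^ n) ^ 3 = 1 := by
    intro g
    let T : Sylow 3 M := IsPGroup.toSylow (IsPGroup.of_card (n := 3) (by rw [hE27]; norm_num)) hn3
    have h27 : (g ^ n) ^ 3 ^ 3 = 1 := by
      rw [← pow_mul]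
      have : n * 3 ^ 3 = Nat.card M := by omega
      rw [this, pow_card_eq_one']
    obtain ⟨h, hh⟩ := conj_into_sylow T _ (isPGroup_zpowers3 _ 3 h27)
    have h1 : h * g ^ n * h⁻¹ ∈ E := hh _ (mem_zpowers _)
    have := hE3 _ h1
    rw [conj_pow, mul_inv_eq_one] at this
    exact mul_eq_left.1 this
  -- transfer
  obtain ⟨V, hVE, hV⟩ := exists_transfer E hEc
  have hVe : V e = e ^ n := hV e (fun k h _ => by
    rw [mul_assoc, ((hem k h).symm).eq, ← mul_assoc, inv_mul_cancel, one_mul])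
  have hVconj : ∀ g x, V (g * x * g⁻¹) = V x := by
    intro g x
    rw [map_mul, map_mul, hEc _ (hVE g) _ (hVE x), mul_assoc, ← map_mul, mul_inv_cancel, map_one,
      mul_one]
  have hVd : V d = d ^ n := hV d (fun k h hk => by
    by_cases h3 : 3 ∣ k
    · obtain ⟨m, rfl⟩ := h3
      rw [pow_mul, hd3]; simp
    · have h1 : (h⁻¹ * d * h⁻¹⁻¹) ^ k ∈ E := by rw [conj_pow, inv_inv]; exact hk
      have h2 := hEc _ hdE _ h1
      have h4 : d * (h⁻¹ * d * h⁻¹⁻¹) = (h⁻¹ * d * h⁻¹⁻¹) * d :=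
        comm_of_pow3 _ _ (by rw [conj_pow, hd3]; simp) k h3 h2
      have h5 := hiso _ h4.symm
      have h6 : (h⁻¹ * d * h⁻¹⁻¹) ^ k = d ^ k := by rw [h5]
      rw [conj_pow, inv_inv] at h6
      exact h6)
  have hVa : V a = 1 := by
    have h1 := hVconj z a
    rw [hz, map_inv] at h1
    have h2 : V a ^ 2 = 1 := by
      rw [pow_two]; nth_rewrite 1 [← h1]; simp
    have h3 := hE3 _ (hVE a)
    rw [pow_succ, h2, one_mul] at h3
    exact h3
  have hVE2 : ∀ i j k : ℕ, V (a ^ i * d ^ j * e ^ k) = d ^ (n * j) * e ^ (n * k) := by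
    intro i j k
    rw [map_mul, map_mul, map_pow, map_pow, map_pow, hVa, hVd, hVe, ← pow_mul, ← pow_mul]
    simp
  -- elements of E with given transfer
  have hVsolve : ∀ i j k m : ℕ, V (a ^ i * d ^ j * e ^ k) = V d ^ m → j % 3 = m % 3 ∧ 3 ∣ k := by
    intro i j k m h
    rw [hVE2, hVd, ← pow_mul] at h
    have h1 : d ^ (n * j + 2 * (n * m)) * e ^ (n * k) = 1 := by
      rw [add_comm, pow_add, mul_assoc, h, ← pow_add]
      rw [show 2 * (n * m) + n * m = 3 * (n * m) by ring, pow_mul, hd3, one_pow]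
    obtain ⟨-, h2, h3⟩ := hind 0 _ _ (by rw [pow_zero, one_mul]; exact h1)
    have h4 : 3 ∣ n * (j + 2 * m) := by convert h2 using 1; ring
    have hp : Nat.Prime 3 := by norm_num
    have h5 := (hp.dvd_mul.1 h4).resolve_left hn3
    exact ⟨by omega, (hp.dvd_mul.1 h3).resolve_left hn3⟩
  have hVsolve1 : ∀ x ∈ E, V x = V d → x = d ∨ x = a * d ∨ x = a ^ 2 * d := by
    intro x hx h
    obtain ⟨i, j, k, rfl⟩ := (hE x).1 hx
    obtain ⟨h1, h2⟩ := hVsolve i j k 1 (by rw [pow_one]; exact h)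
    rw [pow_eq_of_mod3 e he3 k 0 (by omega), pow_eq_of_mod3 d hd3 j 1 h1, pow_zero, mul_one,
      pow_one]
    have : i % 3 = 0 ∨ i % 3 = 1 ∨ i % 3 = 2 := by omega
    rcases this with h | h | h
    · left; rw [pow_eq_of_mod3 a ha3 i 0 h]; simp
    · right; left; rw [pow_eq_of_mod3 a ha3 i 1 h]; simp
    · right; right; rw [pow_eq_of_mod3 a ha3 i 2 h]
  -- F
  set F : Set M := {x | V x = V d} with hF
  have hFcard : F.ncard ≤ 6 * Ω := by
    have h1 : Nat.card (F × (Fin 3 × Fin 3)) ≤ Nat.card M := by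
      refine Nat.card_le_card_of_injective
        (fun t => (t.1 : M) * (d ^ (t.2.1 : ℕ) * e ^ (t.2.2 : ℕ))) ?_
      rintro ⟨⟨x, hx⟩, j, k⟩ ⟨⟨y, hy⟩, j', k'⟩ h
      have hx : V x = V d := hx
      have hy : V y = V d := hy
      have h : x * (d ^ (j : ℕ) * e ^ (k : ℕ)) = y * (d ^ (j' : ℕ) * e ^ (k' : ℕ)) := h
      have h2 := congrArg V h
      rw [map_mul, map_mul V y, hx, hy] at h2
      have h3 := mul_left_cancel h2
      have h4 : V (a ^ 0 * d ^ ((j : ℕ) + 2 * j') * e ^ ((k : ℕ) + 2 * k')) = V d ^ 0 := by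
        have e1 : a ^ 0 * d ^ ((j : ℕ) + 2 * j') * e ^ ((k : ℕ) + 2 * k') =
            (d ^ (j : ℕ) * e ^ (k : ℕ)) * (d ^ (j' : ℕ) * e ^ (k' : ℕ)) ^ 2 := by
          rw [(hem (k' : ℕ) (d ^ (j' : ℕ))).mul_pow, pow_zero, one_mul, pow_add, pow_add, mul_comm 2, mul_comm 2, pow_mul, pow_mul]
          rw [mul_assoc, mul_assoc]
          congr 1
          rw [← mul_assoc, ← mul_assoc, (hem _ _).eq]
        rw [e1, map_mul, map_pow, h3, pow_zero, ← pow_succ']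
        exact hE3 _ (hVE _)
      obtain ⟨h5, h6⟩ := hVsolve _ _ _ _ h4
      have hj : j = j' := by apply Fin.ext; omega
      have hk : k = k' := by apply Fin.ext; omega
      subst hj; subst hk
      have := mul_right_cancel h
      subst this
      rfl
    rw [Nat.card_prod, Nat.card_prod, Nat.card_fin, Nat.card_coe_set_eq] at h1
    omega
  -- O
  set O : Set M := {x | IsConj d x} ∪ {x | IsConj (a * d) x} with hO
  have hCadE : (centralizer {a * d} : Subgroup M) = E := by
    ext g
    rw [mem_centralizer_singleton_iff]
    constructor
    · intro h
      have h1 : g * d = d * g := hCad 1 1 (by norm_num) g (by simpa using h)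
      apply hCa
      have h2 : g * a * d = a * g * d := by
        rw [mul_assoc, h, mul_assoc, mul_assoc, h1]
      exact mul_right_cancel h2
    · intro h
      exact hEc _ h _ (E.mul_mem haE hdE)
  have hOcard : O.ncard = 3 * Ω := by
    rw [hO, Set.ncard_union_eq]
    · have h1 : {x | IsConj d x}.ncard = Ω := by rw [← Nat.card_coe_set_eq]; rfl
      have h2 : {x | IsConj (a * d) x}.ncard * 27 = Nat.card M := by
        rw [← Nat.card_coe_set_eq, ← hE27, ← hCadE]
        exact card_conj_mul (a * d)
      omega
    · rw [Set.disjoint_left]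
      intro x hx hx2
      have h1 : IsConj d (a * d) := IsConj.trans hx (IsConj.symm hx2)
      obtain ⟨g, hg⟩ := isConj_iff.1 h1
      have h2 := hiso g (by rw [hg, mul_assoc a d d, ← mul_assoc d a, had.symm.eq, mul_assoc])
      rw [hg] at h2
      have h3 : a = 1 := mul_eq_right.1 h2
      have := (hind 1 0 0 (by simp [h3])).1
      omega
  have hO3 : ∀ x ∈ O, x ^ 3 = 1 := by
    rintro x (hx | hx)
    · obtain ⟨g, rfl⟩ := isConj_iff.1 hx
      rw [conj_pow, hd3]; simp
    · obtain ⟨g, rfl⟩ := isConj_iff.1 hx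
      rw [conj_pow, hE3 _ (E.mul_mem haE hdE)]; simp
  have hOV : ∀ x ∈ O, V x = V d := by
    rintro x (hx | hx)
    · obtain ⟨g, rfl⟩ := isConj_iff.1 hx
      rw [hVconj]
    · obtain ⟨g, rfl⟩ := isConj_iff.1 hx
      rw [hVconj, map_mul, hVa, one_mul]
  -- the claim
  have claim : ∀ x ∈ O, x * a ∈ O → x = d ∨ x = a * d ∨ x = a ^ 2 * d := by
    intro x hx hxa
    set p := (x⁻¹ * a) ^ n with hp
    obtain ⟨p2, h1, h2, h3⟩ := step3_alg x a ha3 (hO3 _ hx) (hO3 _ hxa) n (hpow _)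
    rw [← hp] at h1 h2 h3
    have hq : p⁻¹ * p2 ∈ E := hCa _ h3.symm
    have hVq : V (p⁻¹ * p2) = 1 := by
      rw [map_mul, ← h1, hVconj, ← map_mul, inv_mul_cancel, map_one]
    have hpa : p * a = a * p := by
      obtain ⟨i, j, k, hijk⟩ := (hE _).1 hq
      rw [hijk] at hVq
      obtain ⟨hj, hk⟩ := hVsolve i j k 0 (by rw [hVq, pow_zero])
      rw [pow_eq_of_mod3 d hd3 j 0 hj, pow_eq_of_mod3 e he3 k 0 (by omega), pow_zero, pow_zero,
        mul_one, mul_one] at hijk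
      by_cases hi : 3 ∣ i
      · rw [pow_eq_of_mod3 a ha3 i 0 (by omega), pow_zero, inv_mul_eq_one] at hijk
        rw [← hijk] at h1
        exact (mul_inv_eq_iff_eq_mul.1 h1).symm
      · apply comm_of_pow3 a p ha3 i hi
        rw [← hijk, mul_inv_cancel_left, mul_assoc, ← h2, inv_mul_cancel_left]
    have hpE := hCa _ hpa
    obtain ⟨i, j, k, hijk⟩ := (hE _).1 hpE
    have hVp : V (a ^ i * d ^ j * e ^ k) = V d ^ (2 * n) := by
      rw [← hijk, hp, map_pow, map_mul, hVa, mul_one, map_inv, hOV x hx, pow_mul]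
      congr 1
      have := hE3 _ (hVE d)
      rw [inv_eq_iff_mul_eq_one, ← pow_succ']
      exact this
    obtain ⟨hj, hk⟩ := hVsolve _ _ _ _ hVp
    rw [pow_eq_of_mod3 e he3 k 0 (by omega), pow_zero, mul_one] at hijk
    have hj3 : ¬ 3 ∣ j := by omega
    have hcp : x⁻¹ * a * p = p * (x⁻¹ * a) := by rw [hp, ← pow_succ', ← pow_succ]
    have hcd : x⁻¹ * a * d = d * (x⁻¹ * a) := by
      rw [hijk] at hcp
      by_cases hi : 3 ∣ i
      · rw [pow_eq_of_mod3 a ha3 i 0 (by omega), pow_zero, one_mul] at hcp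
        exact comm_of_pow3 d _ hd3 j hj3 hcp
      · exact hCad i j hi _ hcp
    have hxd : Commute x d := by
      have e1 : Commute (x⁻¹ * a) d := hcd
      have e2 := e1.mul_left had.inv_left
      rw [mul_inv_cancel_right] at e2
      simpa using e2.inv_left
    have hx2 := hCd2 x hxd
    have hx4 : x = (x ^ 2) ^ 2 := by
      rw [← pow_mul]
      have := hO3 x hx
      calc x = x ^ 3 * x := by rw [this, one_mul]
        _ = x ^ (2 * 2) := by rw [← pow_succ]
    have hxE : x ∈ E := by rw [hx4]; exact E.pow_mem hx2 2
    exact hVsolve1 x hxE (hOV x hx)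
  set S3 : Set M := {d, a * d, a ^ 2 * d} with hS3
  have hS3c : S3.ncard ≤ 3 := by
    refine (Set.ncard_insert_le _ _).trans ?_
    have := Set.ncard_insert_le (a * d) ({a ^ 2 * d} : Set M)
    rw [Set.ncard_singleton] at this
    omega
  have claim' : ∀ x ∈ O \ S3, ∀ y ∈ O \ S3, x ≠ y * a := by
    rintro x ⟨hx, -⟩ y ⟨hy, hyS⟩ h
    apply hyS
    have := claim y hy (h ▸ hx)
    simpa [hS3] using this
  have hO' : O.ncard - 3 ≤ (O \ S3).ncard := by
    have := Set.le_ncard_sdiff S3 O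
    omega
  have hfin : (O \ S3).ncard * 3 ≤ F.ncard := by
    have h1 : Nat.card ((O \ S3 : Set M) × Fin 3) ≤ Nat.card F := by
      refine Nat.card_le_card_of_injective
        (fun t => (⟨(t.1 : M) * a ^ (t.2 : ℕ), ?_⟩ : F)) ?_
      · change V _ = V d
        rw [map_mul, map_pow, hVa, one_pow, mul_one]
        exact hOV _ t.1.2.1
      · rintro ⟨⟨x, hx⟩, i⟩ ⟨⟨y, hy⟩, j⟩ h
        have h : x * a ^ (i : ℕ) = y * a ^ (j : ℕ) := congrArg Subtype.val h
        have key : x = y * a ^ ((j : ℕ) + 2 * i) := by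
          rw [pow_add, ← mul_assoc, ← h, mul_assoc, ← pow_add,
            pow_eq_of_mod3 a ha3 _ 0 (by omega), pow_zero, mul_one]
        have key2 : y = x * a ^ ((i : ℕ) + 2 * j) := by
          rw [pow_add, ← mul_assoc, h, mul_assoc, ← pow_add,
            pow_eq_of_mod3 a ha3 _ 0 (by omega), pow_zero, mul_one]
        have : ((j : ℕ) + 2 * i) % 3 = 0 ∨ ((j : ℕ) + 2 * i) % 3 = 1 ∨
          ((i : ℕ) + 2 * j) % 3 = 1 := by omega
        rcases this with h' | h' | h'
        · have hij : i = j := by apply Fin.ext; omega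
          subst hij
          have := mul_right_cancel h
          subst this
          rfl
        · rw [pow_eq_of_mod3 a ha3 _ 1 h', pow_one] at key
          exact absurd key (claim' x hx y hy)
        · rw [pow_eq_of_mod3 a ha3 _ 1 h', pow_one] at key2
          exact absurd key2 (claim' y hy x hx)
    rw [Nat.card_prod, Nat.card_fin, Nat.card_coe_set_eq, Nat.card_coe_set_eq] at h1
    exact h1
  have hΩ1 : Ω = 1 := by omega
  intro g
  have hs : Subsingleton {x : M // IsConj d x} := (Nat.card_eq_one_iff_unique.1 (hΩ ▸ hΩ1)).1
  have := congrArg Subtype.val (Subsingleton.elim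
    (⟨g * d * g⁻¹, isConj_iff.2 ⟨g, rfl⟩⟩ : {x : M // IsConj d x}) ⟨d, IsConj.refl d⟩)
  exact mul_inv_eq_iff_eq_mul.1 this

/-- The group `3^{1+2} : SL₂(3)`, written in coordinates. -/
@[ext] structure X0 where
  s : ZMod 3
  x : ZMod 3
  y : ZMod 3
  a : ZMod 3
  b : ZMod 3
  c : ZMod 3
  d : ZMod 3
  det : a * d - b * c = 1

namespace X0

instance : Mul X0 := ⟨fun p q => ⟨p.s + q.s + p.x * (p.c * q.x + p.d * q.y)
      - p.y * (p.a * q.x + p.b * q.y),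
    p.x + (p.a * q.x + p.b * q.y), p.y + (p.c * q.x + p.d * q.y),
    p.a * q.a + p.b * q.c, p.a * q.b + p.b * q.d, p.c * q.a + p.d * q.c, p.c * q.b + p.d * q.d,
    by linear_combination (q.a * q.d - q.b * q.c) * p.det + q.det⟩⟩

instance : One X0 := ⟨⟨0, 0, 0, 1, 0, 0, 1, by decide⟩⟩

instance : Inv X0 := ⟨fun p => ⟨-p.s, -(p.d * p.x - p.b * p.y), -(-p.c * p.x + p.a * p.y),
  p.d, -p.b, -p.c, p.a, by linear_combination p.det⟩⟩

section
variable (p q : X0)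
@[simp] theorem mul_s : (p * q).s = p.s + q.s + p.x * (p.c * q.x + p.d * q.y)
      - p.y * (p.a * q.x + p.b * q.y) := rfl
@[simp] theorem mul_x : (p * q).x = p.x + (p.a * q.x + p.b * q.y) := rfl
@[simp] theorem mul_y : (p * q).y = p.y + (p.c * q.x + p.d * q.y) := rfl
@[simp] theorem mul_a : (p * q).a = p.a * q.a + p.b * q.c := rfl
@[simp] theorem mul_b : (p * q).b = p.a * q.b + p.b * q.d := rfl
@[simp] theorem mul_c : (p * q).c = p.c * q.a + p.d * q.c := rfl
@[simp] theorem mul_d : (p * q).d = p.c * q.b + p.d * q.d := rfl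
@[simp] theorem one_s : (1 : X0).s = 0 := rfl
@[simp] theorem one_x : (1 : X0).x = 0 := rfl
@[simp] theorem one_y : (1 : X0).y = 0 := rfl
@[simp] theorem one_a : (1 : X0).a = 1 := rfl
@[simp] theorem one_b : (1 : X0).b = 0 := rfl
@[simp] theorem one_c : (1 : X0).c = 0 := rfl
@[simp] theorem one_d : (1 : X0).d = 1 := rfl
end

instance : Group X0 := Group.ofLeftAxioms
  (fun p q r => by
    ext <;> simp
    · linear_combination (q.x * (q.c * r.x + q.d * r.y) - q.y * (q.a * r.x + q.b * r.y)) * p.det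
    all_goals ring)
  (fun p => by ext <;> simp)
  (fun p => by
    have h := p.det
    ext
    · change -p.s + p.s + -(p.d * p.x - p.b * p.y) * (-p.c * p.x + p.a * p.y)
        - -(-p.c * p.x + p.a * p.y) * (p.d * p.x + -p.b * p.y) = 0
      ring
    · change -(p.d * p.x - p.b * p.y) + (p.d * p.x + -p.b * p.y) = 0
      ring
    · change -(-p.c * p.x + p.a * p.y) + (-p.c * p.x + p.a * p.y) = 0
      ring
    · change p.d * p.a + -p.b * p.c = 1
      linear_combination h
    · change p.d * p.b + -p.b * p.d = 0
      ring
    · change -p.c * p.a + p.a * p.c = 0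
      ring
    · change -p.c * p.b + p.a * p.d = 1
      linear_combination h)

/-- decidable equality -/
instance : DecidableEq X0 := fun p q =>
  decidable_of_iff (p.s = q.s ∧ p.x = q.x ∧ p.y = q.y ∧ p.a = q.a ∧ p.b = q.b ∧ p.c = q.c ∧ p.d = q.d)
    (by rw [X0.ext_iff])

def d0 : X0 := ⟨1, 0, 0, 1, 0, 0, 1, by decide⟩
def a0 : X0 := ⟨0, 1, 0, 1, 0, 0, 1, by decide⟩
def b0 : X0 := ⟨0, 0, 1, 1, 0, 0, 1, by decide⟩
def e0 : X0 := ⟨0, 0, 0, 1, 1, 0, 1, by decide⟩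
def z0 : X0 := ⟨0, 0, 0, -1, 0, 0, -1, by decide⟩

/-- elements of the extraspecial normal subgroup -/
def q0 (s x y : ZMod 3) : X0 := ⟨s, x, y, 1, 0, 0, 1, by decide⟩
/-- elements of the complement -/
def k0 (p : X0) : X0 := ⟨0, 0, 0, p.a, p.b, p.c, p.d, p.det⟩
/-- elements of the Sylow subgroup -/
def p0 (s x y k : ZMod 3) : X0 := ⟨s, x, y, 1, k, 0, 1, by ring⟩

theorem q0_mul_k0 (p : X0) : q0 p.s p.x p.y * k0 p = p := by
  ext <;> simp [q0, k0]

theorem d0_comm (p : X0) : p * d0 = d0 * p := by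
  ext <;> simp [d0, add_comm]

theorem d0_cube : d0 ^ 3 = 1 := by decide
theorem a0_cube : a0 ^ 3 = 1 := by decide
theorem e0_cube : e0 ^ 3 = 1 := by decide
theorem z0_sq : z0 ^ 2 = 1 := by decide

theorem comm_a (p : X0) (ha : p * a0 = a0 * p) : p = p0 p.s p.x 0 p.b := by
  obtain ⟨s, x, y, a, b, c, d, h⟩ := p
  simp [X0.ext_iff, a0, p0] at *
  revert s x y a b c d
  decide

/-- the centralizer of `a0` and `b0` -/
theorem comm_ab (p : X0) (ha : p * a0 = a0 * p) (hb : p * b0 = b0 * p) : p = q0 p.s 0 0 := by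
  have h := comm_a p ha
  rw [h] at hb ⊢
  generalize p.s = s at *
  generalize p.x = x at *
  generalize p.b = b at *
  simp [X0.ext_iff, b0, q0, p0] at *
  clear ha h
  revert s x b
  decide

/-- the normal subgroup of index three -/
def InY (p : X0) : Prop := (p.b = 0 ∧ p.c = 0 ∧ p.a = p.d) ∨ p.a + p.d = 0

theorem k0_pow4 (p : X0) (h : InY p) : k0 p ^ 4 = 1 := by
  obtain ⟨s, x, y, a, b, c, d, hd⟩ := p
  simp only [InY, X0.ext_iff, k0, pow_succ, pow_zero, mul_s, mul_x, mul_y, mul_a, mul_b, mul_c,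
    mul_d, one_s, one_x, one_y, one_a, one_b, one_c, one_d] at *
  simp
  clear s x y
  revert a b c d
  decide

theorem q0_pow (s x y : ZMod 3) (n : ℕ) : q0 s x y ^ n = q0 (n * s) (n * x) (n * y) := by
  induction n with
  | zero => simp [q0, X0.ext_iff]
  | succ n ih => rw [pow_succ, ih]; ext <;> simp [q0] <;> ring

theorem q0_cube (s x y : ZMod 3) : q0 s x y ^ 3 = 1 := by
  rw [q0_pow]
  have : ((3 : ℕ) : ZMod 3) = 0 := by decide
  rw [this]; simp [q0, X0.ext_iff]

theorem q0_eq_d0 (s : ZMod 3) : q0 s 0 0 = d0 ^ s.val := by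
  have : d0 = q0 1 0 0 := rfl
  rw [this, q0_pow]; simp

theorem exists_e0_mul (p : X0) : ∃ k : ℕ, k < 3 ∧ InY (e0 ^ k * p) := by
  have h : InY (e0 ^ 0 * p) ∨ InY (e0 ^ 1 * p) ∨ InY (e0 ^ 2 * p) := by
    obtain ⟨s, x, y, a, b, c, d, hd⟩ := p
    simp only [InY, pow_succ, pow_zero, mul_a, mul_b, mul_c,
      mul_d, one_a, one_b, one_c, one_d, e0] at *
    clear s x y
    revert a b c d
    decide
  rcases h with h | h | h
  exacts [⟨0, by norm_num, h⟩, ⟨1, by norm_num, h⟩, ⟨2, by norm_num, h⟩]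

/-- the linear part of an element is a homomorphism -/
theorem k0_mul (p q : X0) : k0 (p * q) = k0 p * k0 q := by
  ext <;> simp [k0]

theorem k0_one : k0 1 = 1 := by decide

theorem k0_pow (p : X0) (n : ℕ) : k0 (p ^ n) = k0 p ^ n := by
  induction n with
  | zero => simp [k0_one]
  | succ n ih => rw [pow_succ, pow_succ, k0_mul, ih]

theorem eq_q0_of_k0 (p : X0) (h : k0 p = 1) : p = q0 p.s p.x p.y := by
  conv_lhs => rw [← q0_mul_k0 p, h, mul_one]

theorem inY_cube (p : X0) (h : InY p) (h3 : p ^ 3 = 1) : p = q0 p.s p.x p.y := by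
  apply eq_q0_of_k0
  have h4 := k0_pow4 p h
  rw [pow_succ, ← k0_pow, h3, k0_one, one_mul] at h4
  exact h4

theorem inY_pow12 (p : X0) (h : InY p) : p ^ 12 = 1 := by
  have h4 := k0_pow4 p h
  rw [← k0_pow] at h4
  rw [show 12 = 4 * 3 by norm_num, pow_mul, eq_q0_of_k0 _ h4, q0_cube]

/-- all noncentral elements of the extraspecial group are conjugate -/
theorem q0_conj (s x y : ZMod 3) (h : x ≠ 0 ∨ y ≠ 0) : ∃ g, g * a0 * g⁻¹ = q0 s x y := by
  have key : ∀ g, g * a0 = q0 s x y * g → g * a0 * g⁻¹ = q0 s x y := fun g hg => by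
    rw [hg, mul_inv_cancel_right]
  by_cases hx : x = 0
  · have hy : y ≠ 0 := h.resolve_left (fun h => h hx)
    refine ⟨⟨0, -s * y, 0, 0, -y, y, 0, ?_⟩, key _ ?_⟩
    · clear key h hx; revert y; decide
    · subst hx
      clear h key
      simp [X0.ext_iff, a0, q0]
      revert s y
      decide
  · refine ⟨⟨0, 0, s * x, x, 0, y, x, ?_⟩, key _ ?_⟩
    · clear key h; rw [zero_mul, sub_zero]; revert x; decide
    · clear h key
      simp [X0.ext_iff, a0, q0]
      revert s x y
      decide

theorem a0_inv_conj : ∃ g : X0, g * a0 * g⁻¹ = a0⁻¹ := ⟨z0, by decide⟩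

theorem q0_conj_inv (s x y : ZMod 3) (h : x ≠ 0 ∨ y ≠ 0) :
    ∃ g, g * q0 s x y * g⁻¹ = (q0 s x y)⁻¹ := by
  obtain ⟨g, hg⟩ := q0_conj s x y h
  obtain ⟨k, hk⟩ := a0_inv_conj
  refine ⟨g * k * g⁻¹, ?_⟩
  rw [← hg]
  have : (g * a0 * g⁻¹)⁻¹ = g * (k * a0 * k⁻¹) * g⁻¹ := by rw [hk]; group
  rw [this]; group

/-- involutions -/
theorem invol (p : X0) (h2 : p ^ 2 = 1) (h1 : p ≠ 1) : p = ⟨0, p.x, p.y, -1, 0, 0, -1, by decide⟩ := by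
  have hk : k0 p = 1 ∨ k0 p = z0 := by
    rw [pow_two] at h2
    clear h1
    obtain ⟨s, x, y, a, b, c, d, hd⟩ := p
    simp [k0, z0, X0.ext_iff] at *
    obtain ⟨-, -, -, h⟩ := h2
    clear s x y
    revert a b c d
    decide
  rcases hk with hk | hk
  · exfalso
    apply h1
    have h3 : p ^ 3 = 1 := by rw [eq_q0_of_k0 p hk, q0_cube]
    rw [pow_succ, h2, one_mul] at h3
    exact h3
  · rw [pow_two] at h2
    clear h1
    obtain ⟨s, x, y, a, b, c, d, hd⟩ := p
    simp [k0, z0, X0.ext_iff] at *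
    obtain ⟨rfl, rfl, rfl, rfl⟩ := hk
    simp
    have := h2.1
    clear h2 hd
    revert s x y
    decide

theorem invol_conj (x y : ZMod 3) :
    ∃ g : X0, g * z0 * g⁻¹ = ⟨0, x, y, -1, 0, 0, -1, by decide⟩ := by
  refine ⟨q0 0 (-x) (-y), ?_⟩
  rw [mul_inv_eq_iff_eq_mul]
  simp [X0.ext_iff, z0, q0]
  revert x y
  decide

/-- normalizing the subgroup generated by `e0` -/
theorem norm_e0 (p : X0) (k : ℕ) (h : k0 p * e0 = e0 ^ k * k0 p) : k0 p * e0 = e0 * k0 p := by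
  rw [pow_eq_of_mod3 e0 e0_cube k (k % 3) (by simp)] at h
  have hk : k % 3 < 3 := Nat.mod_lt _ (by norm_num)
  generalize k % 3 = r at *
  interval_cases r
  · rw [pow_zero, one_mul] at h
    have : e0 = 1 := by exact mul_eq_left.1 h
    exact absurd this (by decide)
  · rw [pow_one] at h; exact h
  · exfalso
    rw [pow_two] at h
    obtain ⟨s, x, y, a, b, c, d, hd⟩ := p
    simp [k0, e0, X0.ext_iff] at *
    clear s x y
    revert a b c d
    decide

theorem comm_z0 (p : X0) (h : p * z0 = z0 * p) : p.x = 0 ∧ p.y = 0 := by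
  obtain ⟨s, x, y, a, b, c, d, hd⟩ := p
  simp [z0, X0.ext_iff] at *
  clear hd
  revert x y
  decide

/-- the centralizer of `e0` -/
theorem comm_e0 (p : X0) (h : p * e0 = e0 * p) : p.y = 0 ∧ p.c = 0 ∧ p.a = p.d := by
  obtain ⟨s, x, y, a, b, c, d, hd⟩ := p
  simp [e0, X0.ext_iff] at *
  grind

theorem comm_e0' (p : X0) (hy : p.y = 0) (hc : p.c = 0) (hd : p.a = p.d) : p * e0 = e0 * p := by
  ext <;> simp [e0, hy, hc, hd, add_comm]

theorem comm_e0_sq (p : X0) (h : p * e0 = e0 * p) : ∃ s x k, p ^ 2 = p0 s x 0 k := by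
  obtain ⟨hy, hc, ha⟩ := comm_e0 p h
  refine ⟨(p ^ 2).s, (p ^ 2).x, (p ^ 2).b, ?_⟩
  have hdet := p.det
  rw [pow_two]
  rw [hc, ha] at hdet
  ext <;> simp [p0, hc, hy, ha]
  · linear_combination hdet
  · linear_combination hdet

theorem p0_eq (s x k : ZMod 3) : p0 s x 0 k = a0 ^ x.val * d0 ^ s.val * e0 ^ k.val := by
  revert s x k
  decide

theorem pow_mem_E0 (i j k : ℕ) : a0 ^ i * d0 ^ j * e0 ^ k = p0 j i 0 k := by
  rw [p0_eq]
  congr 1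
  · congr 1
    · exact pow_eq_of_mod3 _ a0_cube _ _ (by rw [ZMod.val_natCast]; simp)
    · exact pow_eq_of_mod3 _ d0_cube _ _ (by rw [ZMod.val_natCast]; simp)
  · exact pow_eq_of_mod3 _ e0_cube _ _ (by rw [ZMod.val_natCast]; simp)

theorem p0_mul (s x y k s' x' y' k' : ZMod 3) : p0 s x y k * p0 s' x' y' k' =
    p0 (s + s' + x * y' - y * (x' + k * y')) (x + x' + k * y') (y + y') (k + k') := by
  ext <;> simp [p0] <;> ring

theorem p0_inv (s x y k : ZMod 3) : (p0 s x y k)⁻¹ = p0 (-s) (k * y - x) (-y) (-k) := by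
  rw [inv_eq_iff_mul_eq_one, p0_mul]
  ext <;> simp [p0]
  ring

theorem p0_one : (1 : X0) = p0 0 0 0 0 := by decide

/-- the Sylow 3-subgroup -/
def P0 : Subgroup X0 where
  carrier := {p | ∃ s x y k, p = p0 s x y k}
  mul_mem' := by
    rintro _ _ ⟨s, x, y, k, rfl⟩ ⟨s', x', y', k', rfl⟩
    exact ⟨_, _, _, _, p0_mul _ _ _ _ _ _ _ _⟩
  one_mem' := ⟨_, _, _, _, p0_one⟩
  inv_mem' := by
    rintro _ ⟨s, x, y, k, rfl⟩
    exact ⟨_, _, _, _, p0_inv _ _ _ _⟩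

/-- the elementary abelian subgroup of order 27 -/
def E0 : Subgroup X0 where
  carrier := {p | ∃ s x k, p = p0 s x 0 k}
  mul_mem' := by
    rintro _ _ ⟨s, x, k, rfl⟩ ⟨s', x', k', rfl⟩
    refine ⟨s + s', x + x', k + k', ?_⟩
    rw [p0_mul]; simp
  one_mem' := ⟨_, _, _, p0_one⟩
  inv_mem' := by
    rintro _ ⟨s, x, k, rfl⟩
    exact ⟨-s, -x, -k, by rw [p0_inv]; simp⟩

/-- the subgroup generated by `d0` and `e0` -/
def B0 : Subgroup X0 where
  carrier := {p | ∃ s k, p = p0 s 0 0 k}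
  mul_mem' := by
    rintro _ _ ⟨s, k, rfl⟩ ⟨s', k', rfl⟩
    refine ⟨s + s', k + k', ?_⟩
    rw [p0_mul]; simp
  one_mem' := ⟨_, _, p0_one⟩
  inv_mem' := by
    rintro _ ⟨s, k, rfl⟩
    exact ⟨-s, -k, by rw [p0_inv]; simp⟩

/-- coordinates -/
def equivCoord : X0 ≃ (ZMod 3 × ZMod 3 × ZMod 3) ×
    {q : ZMod 3 × ZMod 3 × ZMod 3 × ZMod 3 // q.1 * q.2.2.2 - q.2.1 * q.2.2.1 = 1} where
  toFun p := ((p.s, p.x, p.y), ⟨(p.a, p.b, p.c, p.d), p.det⟩)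
  invFun q := ⟨q.1.1, q.1.2.1, q.1.2.2, q.2.1.1, q.2.1.2.1, q.2.1.2.2.1, q.2.1.2.2.2, q.2.2⟩
  left_inv _ := rfl
  right_inv _ := rfl

instance : Finite X0 := Finite.of_equiv _ equivCoord.symm

theorem card_SL : Fintype.card
    {q : ZMod 3 × ZMod 3 × ZMod 3 × ZMod 3 // q.1 * q.2.2.2 - q.2.1 * q.2.2.1 = 1} = 24 := by
  decide

theorem card_X0 : Nat.card X0 = 648 := by
  rw [Nat.card_congr equivCoord, Nat.card_prod, Nat.card_eq_fintype_card (α := Subtype _), card_SL]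
  simp

theorem p0_inj {s x y k s' x' y' k' : ZMod 3} (h : p0 s x y k = p0 s' x' y' k') :
    s = s' ∧ x = x' ∧ y = y' ∧ k = k' := by
  simpa [p0] using h

theorem card_P0 : Nat.card P0 = 81 := by
  have : Function.Bijective (fun q : ZMod 3 × ZMod 3 × ZMod 3 × ZMod 3 =>
      (⟨p0 q.1 q.2.1 q.2.2.1 q.2.2.2, _, _, _, _, rfl⟩ : P0)) := by
    constructor
    · rintro ⟨_, _, _, _⟩ ⟨_, _, _, _⟩ h
      obtain ⟨h1, h2, h3, h4⟩ := p0_inj (congrArg Subtype.val h)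
      simp only [] at h1 h2 h3 h4
      simp only [h1, h2, h3, h4]
    · rintro ⟨_, s, x, y, k, rfl⟩
      exact ⟨(s, x, y, k), rfl⟩
  rw [← Nat.card_congr (Equiv.ofBijective _ this)]
  simp

theorem card_E0 : Nat.card E0 = 27 := by
  have : Function.Bijective (fun q : ZMod 3 × ZMod 3 × ZMod 3 =>
      (⟨p0 q.1 q.2.1 0 q.2.2, _, _, _, rfl⟩ : E0)) := by
    constructor
    · rintro ⟨_, _, _⟩ ⟨_, _, _⟩ h
      obtain ⟨h1, h2, h3, h4⟩ := p0_inj (congrArg Subtype.val h)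
      simp only [] at h1 h2 h3 h4
      simp only [h1, h2, h4]
    · rintro ⟨_, s, x, k, rfl⟩
      exact ⟨(s, x, k), rfl⟩
  rw [← Nat.card_congr (Equiv.ofBijective _ this)]
  simp

theorem card_B0 : Nat.card B0 = 9 := by
  have : Function.Bijective (fun q : ZMod 3 × ZMod 3 =>
      (⟨p0 q.1 0 0 q.2, _, _, rfl⟩ : B0)) := by
    constructor
    · rintro ⟨_, _⟩ ⟨_, _⟩ h
      obtain ⟨h1, h2, h3, h4⟩ := p0_inj (congrArg Subtype.val h)
      simp only [] at h1 h2 h3 h4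
      simp only [h1, h4]
    · rintro ⟨_, s, k, rfl⟩
      exact ⟨(s, k), rfl⟩
  rw [← Nat.card_congr (Equiv.ofBijective _ this)]
  simp

/-- the centralizer of `z0` -/
def equivCz : {p : X0 // p * z0 = z0 * p} ≃ ZMod 3 ×
    {q : ZMod 3 × ZMod 3 × ZMod 3 × ZMod 3 // q.1 * q.2.2.2 - q.2.1 * q.2.2.1 = 1} where
  toFun p := (p.1.s, ⟨(p.1.a, p.1.b, p.1.c, p.1.d), p.1.det⟩)
  invFun q := ⟨⟨q.1, 0, 0, q.2.1.1, q.2.1.2.1, q.2.1.2.2.1, q.2.1.2.2.2, q.2.2⟩, by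
    ext <;> simp [z0]⟩
  left_inv p := by
    obtain ⟨h1, h2⟩ := comm_z0 p.1 p.2
    apply Subtype.ext
    ext
    all_goals first | rfl | exact h1.symm | exact h2.symm
  right_inv _ := rfl

theorem card_Cz : Nat.card {p : X0 // p * z0 = z0 * p} = 72 := by
  rw [Nat.card_congr equivCz, Nat.card_prod, Nat.card_eq_fintype_card (α := Subtype _), card_SL]
  simp

/-- the centralizer of `e0` -/
def equivCe : {p : X0 // p * e0 = e0 * p} ≃ (ZMod 3 × ZMod 3 × ZMod 3) ×
    {q : ZMod 3 // q * q = 1} where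
  toFun p := ((p.1.s, p.1.x, p.1.b), ⟨p.1.a, by
    obtain ⟨h1, h2, h3⟩ := comm_e0 p.1 p.2
    have := p.1.det
    rw [h2, ← h3, mul_zero, sub_zero] at this
    exact this⟩)
  invFun q := ⟨⟨q.1.1, q.1.2.1, 0, q.2.1, q.1.2.2, 0, q.2.1, by rw [mul_zero, sub_zero]; exact q.2.2⟩,
    comm_e0' _ rfl rfl rfl⟩
  left_inv p := by
    obtain ⟨h1, h2, h3⟩ := comm_e0 p.1 p.2
    apply Subtype.ext
    ext
    all_goals first | rfl | exact h1.symm | exact h2.symm | exact h3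
  right_inv _ := rfl

theorem card_Ce : Nat.card {p : X0 // p * e0 = e0 * p} = 54 := by
  have : Fintype.card {q : ZMod 3 // q * q = 1} = 2 := by decide
  rw [Nat.card_congr equivCe, Nat.card_prod, Nat.card_eq_fintype_card (α := Subtype _), this]
  simp

/-- homomorphisms to groups of order three -/
theorem hom_InY {Q : Type*} [Group Q] (hQ3 : ∀ x : Q, x ^ 3 = 1) (hQc : ∀ x y : Q, x * y = y * x)
    (φ : X0 →* Q) (p : X0) (hp : InY p) : φ p = 1 := by
  have h4 : ∀ x : Q, x ^ 2 = 1 → x = 1 := by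
    intro x hx
    have := hQ3 x
    rwa [pow_succ, hx, one_mul] at this
  have hconj : ∀ g q, φ (g * q * g⁻¹) = φ q := by
    intro g q
    rw [map_mul, map_mul, hQc (φ g), mul_assoc, ← map_mul, mul_inv_cancel, map_one, mul_one]
  have hd : φ d0 = 1 := by
    have h1 : d0 = (b0 * a0 * b0⁻¹) * a0⁻¹ := by decide
    rw [h1, map_mul, hconj, ← map_mul, mul_inv_cancel, map_one]
  have hq : φ (q0 p.s p.x p.y) = 1 := by
    apply h4
    have h1 : z0 * q0 p.s p.x p.y * z0⁻¹ = q0 p.s (-p.x) (-p.y) := by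
      rw [mul_inv_eq_iff_eq_mul]
      ext <;> simp [z0, q0]
    have h2 : q0 p.s (-p.x) (-p.y) * q0 p.s p.x p.y = q0 (p.s + p.s) 0 0 := by
      ext <;> simp [q0]
      ring
    have h3 := hconj z0 (q0 p.s p.x p.y)
    rw [h1] at h3
    rw [pow_two]
    nth_rewrite 1 [← h3]
    rw [← map_mul, h2, q0_eq_d0, map_pow, hd, one_pow]
  have hk : φ (k0 p) = 1 := by
    have h1 : φ (k0 p) ^ 4 = 1 := by rw [← map_pow, k0_pow4 p hp, map_one]
    rwa [pow_succ, hQ3, one_mul] at h1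
  rw [← q0_mul_k0 p, map_mul, hq, hk, one_mul]

theorem inY_of_hom {Q : Type*} [Group Q] (hQ3 : ∀ x : Q, x ^ 3 = 1) (hQc : ∀ x y : Q, x * y = y * x)
    (φ : X0 →* Q) (hφ : ∃ q, φ q ≠ 1) (p : X0) (hp : φ p = 1) : InY p := by
  have he : φ e0 ≠ 1 := by
    intro he
    obtain ⟨q, hq⟩ := hφ
    obtain ⟨k, -, hk⟩ := exists_e0_mul q
    have := hom_InY hQ3 hQc φ _ hk
    rw [map_mul, map_pow, he, one_pow, one_mul] at this
    exact hq this
  obtain ⟨k, hk3, hk⟩ := exists_e0_mul p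
  have := hom_InY hQ3 hQc φ _ hk
  rw [map_mul, map_pow, hp, mul_one] at this
  have h3 := hQ3 (φ e0)
  interval_cases k
  · simpa using hk
  · rw [pow_one] at this; exact absurd this he
  · rw [pow_succ, this, one_mul] at h3; exact absurd h3 he

end X0

/-- Variant of `core4` with a central involution. -/
theorem core4' {G : Type*} [Group G] [Finite G] (W : Subgroup G) (hW : W.Normal)
    (hc : (Nat.card W).Coprime 3) (d e z : G) (hde : d * e = e * d) (hd : d ^ 3 = 1)
    (he : e ^ 3 = 1) (hz : ∀ g, g * z = z * g) (hz2 : z ^ 2 = 1)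
    (hf : ∀ i : ℕ, ∀ w ∈ W, w * (e * d ^ i) = (e * d ^ i) * w → w = 1 ∨ w = z) :
    ∀ w ∈ W, w * d = d * w := by
  have hzz : z * z = 1 := by rw [← pow_two, hz2]
  let Z : Subgroup G := zpowers z
  have hmem : ∀ g, g ∈ Z ↔ g = 1 ∨ g = z := by
    intro g
    constructor
    · intro hg
      obtain ⟨k, rfl⟩ := mem_zpowers_iff.1 hg
      rcases Int.even_or_odd' k with ⟨m, rfl | rfl⟩
      · left; rw [zpow_mul, zpow_ofNat, hz2, one_zpow]
      · right; rw [zpow_add, zpow_mul, zpow_ofNat, hz2, one_zpow, one_mul, zpow_one]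
    · rintro (rfl | rfl)
      · exact one_mem _
      · exact mem_zpowers _
  have hZn : Z.Normal := by
    constructor
    intro n hn g
    rcases (hmem n).1 hn with rfl | rfl
    · simp
    · rw [hz g, mul_inv_cancel_right]; exact hn
  -- commuting modulo z implies commuting, for elements of order three
  have lift : ∀ x w : G, x ^ 3 = 1 → ((w : G ⧸ Z)) * x = (x : G ⧸ Z) * w → w * x = x * w := by
    intro x w hx h
    rw [← QuotientGroup.mk_mul, ← QuotientGroup.mk_mul, QuotientGroup.eq] at h
    rcases (hmem _).1 h with h | h
    · rw [inv_mul_eq_one] at h; exact h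
    · have h1 : x * w = w * x * z := by rw [← h, mul_inv_cancel_left]
      have h2 : w⁻¹ * x * w⁻¹⁻¹ = x * z := by
        rw [inv_inv, mul_assoc, h1]; group
      have h3 : (w⁻¹ * x * w⁻¹⁻¹) ^ 3 = 1 := by rw [conj_pow, hx]; simp
      have hxz : Commute x z := hz x
      rw [h2, hxz.mul_pow, hx, one_mul, pow_succ, hz2, one_mul] at h3
      rw [h1, h3, mul_one]
  have hC : Commute d e := hde
  intro w hw
  apply lift d w hd
  refine core4 (W.map (QuotientGroup.mk' Z)) (hW.map _ (QuotientGroup.mk'_surjective Z)) ?_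
    (d : G ⧸ Z) (e : G ⧸ Z) ?_ ?_ ?_ ?_ (w : G ⧸ Z) ⟨w, hw, rfl⟩
  · exact Nat.Coprime.coprime_dvd_left (Subgroup.card_map_dvd W _) hc
  · rw [← QuotientGroup.mk_mul, hde, QuotientGroup.mk_mul]
  · rw [← QuotientGroup.mk_pow, hd, QuotientGroup.mk_one]
  · rw [← QuotientGroup.mk_pow, he, QuotientGroup.mk_one]
  · rintro i _ ⟨v, hv, rfl⟩ h
    have hx3 : (e * d ^ i) ^ 3 = 1 := by
      rw [(hC.symm.pow_right i).mul_pow, he, ← pow_mul, mul_comm i, pow_mul, hd]; simp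
    have := hf i v hv (lift _ _ hx3 h)
    rw [← hmem] at this
    exact (QuotientGroup.eq_one_iff v).2 this

/-- The working configuration. -/
structure Cfg {H : Type*} [Group H] (ι : X0 →* H) (K : Subgroup H) : Prop where
  inj : Function.Injective ι
  cent : ∀ g, g * ι X0.d0 = ι X0.d0 * g → ∃ p, ι p = g
  nc : ∀ h, h * ι X0.d0 * h⁻¹ ≠ (ι X0.d0)⁻¹
  sig : ∀ Y : Subgroup H, (Nat.card Y).Coprime 3 →
    (∀ e ∈ X0.E0, ∀ y ∈ Y, ι e * y * (ι e)⁻¹ ∈ Y) → Y = ⊥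
  knorm : K.Normal
  kidx : K.index = 3

namespace Cfg
open X0
set_option linter.unusedSectionVars false
variable {H : Type*} [Group H] [Finite H] {ι : X0 →* H} {K : Subgroup H}

theorem commX (p : X0) : ι p * ι d0 = ι d0 * ι p := by
  rw [← map_mul, d0_comm, map_mul]

theorem d3 : (ι d0) ^ 3 = 1 := by rw [← map_pow, d0_cube, map_one]

theorem comm_lift (h : Cfg ι K) {p q : X0} (hpq : ι p * ι q = ι q * ι p) : p * q = q * p := by
  apply h.inj; rw [map_mul, hpq, map_mul]

theorem sylow (h : Cfg ι K) : ∃ S : Sylow 3 H, ι d0 ∈ (S : Subgroup H) ∧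
    ∀ s ∈ (S : Subgroup H), ∃ p, ι p = s := by
  have : Fact (Nat.Prime 3) := ⟨by norm_num⟩
  have hP : IsPGroup 3 P0 := IsPGroup.of_card (n := 4) (by rw [card_P0]; norm_num)
  obtain ⟨S, hS⟩ := (hP.map ι).exists_le_sylow
  have hmem : ∀ s x y k, ι (p0 s x y k) ∈ (S : Subgroup H) := fun s x y k =>
    hS ⟨_, ⟨s, x, y, k, rfl⟩, rfl⟩
  have ha : ι a0 ∈ (S : Subgroup H) := hmem 0 1 0 0
  have hb : ι b0 ∈ (S : Subgroup H) := hmem 0 0 1 0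
  have hd : ι d0 ∈ (S : Subgroup H) := hmem 1 0 0 0
  have hnt : Nontrivial (S : Subgroup H) := by
    refine ⟨⟨⟨ι d0, hd⟩, 1, fun h' => ?_⟩⟩
    have h1 : ι d0 = 1 := congrArg Subtype.val h'
    rw [← map_one ι] at h1
    exact absurd (h.inj h1) (by decide)
  have := S.2.center_nontrivial
  obtain ⟨⟨⟨x, hxS⟩, hxZ⟩, hx1⟩ := exists_ne (1 : center (S : Subgroup H))
  have hxc : ∀ t ∈ (S : Subgroup H), t * x = x * t := fun t ht =>
    congrArg Subtype.val (mem_center_iff.1 hxZ ⟨t, ht⟩)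
  obtain ⟨p, rfl⟩ := h.cent x (hxc _ hd).symm
  have hp := comm_ab p (h.comm_lift (hxc _ ha).symm) (h.comm_lift (hxc _ hb).symm)
  rw [q0_eq_d0] at hp
  have hs : ¬ 3 ∣ p.s.val := by
    intro h3
    have h0 : p.s.val = 0 := Nat.eq_zero_of_dvd_of_lt h3 (ZMod.val_lt _)
    rw [h0, pow_zero] at hp
    apply hx1
    apply Subtype.ext; apply Subtype.ext
    change ι p = 1
    rw [hp, map_one]
  refine ⟨S, hd, fun t ht => ?_⟩
  apply h.cent
  apply comm_of_pow3 _ _ d3 _ hs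
  rw [← map_pow, ← hp]
  exact hxc t ht

theorem exists_notMem (h : Cfg ι K) : ∃ p, ι p ∉ K := by
  by_contra! hK
  have : Fact (Nat.Prime 3) := ⟨by norm_num⟩
  obtain ⟨S, hd, hS⟩ := h.sylow
  have hSK : (S : Subgroup H) ≤ K := by
    intro s hs
    obtain ⟨p, rfl⟩ := hS s hs
    exact hK p
  apply S.not_dvd_index
  have h3 := Subgroup.index_dvd_of_le hSK
  rw [h.kidx] at h3
  exact h3

theorem mem_K_iff (h : Cfg ι K) (p : X0) : ι p ∈ K ↔ InY p := by
  have := h.knorm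
  have : Fact (Nat.Prime 3) := ⟨by norm_num⟩
  have hcard : Nat.card (H ⧸ K) = 3 := h.kidx
  have hQ3 : ∀ x : H ⧸ K, x ^ 3 = 1 := fun x => by rw [← hcard, pow_card_eq_one']
  have hcyc : IsCyclic (H ⧸ K) := isCyclic_of_prime_card hcard
  have hQc : ∀ x y : H ⧸ K, x * y = y * x := fun x y => (IsCyclic.commGroup (α := H ⧸ K)).mul_comm x y
  let φ := (QuotientGroup.mk' K).comp ι
  have hφ : ∀ p, φ p = 1 ↔ ι p ∈ K := fun p => QuotientGroup.eq_one_iff _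
  rw [← hφ]
  constructor
  · refine inY_of_hom hQ3 hQc φ ?_ p
    obtain ⟨q, hq⟩ := h.exists_notMem
    exact ⟨q, fun h' => hq ((hφ q).1 h')⟩
  · exact hom_InY hQ3 hQc φ p

theorem iso (h : Cfg ι K) (g : H) (p : X0) (hg : g * ι d0 * g⁻¹ = ι p) :
    g * ι d0 * g⁻¹ = ι d0 := by
  have := h.knorm
  have hdK : ι d0 ∈ K := (h.mem_K_iff d0).2 (Or.inl (by decide))
  have hpK : ι p ∈ K := by rw [← hg]; exact h.knorm.conj_mem _ hdK g
  have hpY := (h.mem_K_iff p).1 hpK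
  have hp3 : p ^ 3 = 1 := by
    apply h.inj
    rw [map_pow, ← hg, conj_pow, d3, map_one]; simp
  have hp := inY_cube p hpY hp3
  by_cases hxy : p.x ≠ 0 ∨ p.y ≠ 0
  · exfalso
    obtain ⟨k, hk⟩ := q0_conj_inv p.s p.x p.y hxy
    rw [← hp] at hk
    apply h.nc (g⁻¹ * ι k * g)
    calc g⁻¹ * ι k * g * ι d0 * (g⁻¹ * ι k * g)⁻¹
        = g⁻¹ * (ι k * (g * ι d0 * g⁻¹) * (ι k)⁻¹) * g := by group
      _ = g⁻¹ * (g * ι d0 * g⁻¹)⁻¹ * g := by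
          rw [hg, ← map_mul, ← map_inv, ← map_mul, hk, map_inv]
      _ = _ := by group
  · push Not at hxy
    rw [hxy.1, hxy.2] at hp
    generalize p.s = s at hp
    subst hp
    have hs : s = 0 ∨ s = 1 ∨ s = 2 := by clear * -; revert s; decide
    rcases hs with rfl | rfl | rfl
    · exfalso
      rw [show q0 0 0 0 = 1 from rfl, map_one, mul_inv_eq_one, mul_eq_left, ← map_one ι] at hg
      exact absurd (h.inj hg) (by decide)
    · exact hg
    · exfalso
      apply h.nc g
      rw [hg, ← map_inv]
      congr 1

theorem iso' (h : Cfg ι K) (g : H) (hg : (g * ι d0 * g⁻¹) * ι d0 = ι d0 * (g * ι d0 * g⁻¹)) :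
    g * ι d0 * g⁻¹ = ι d0 := by
  obtain ⟨p, hp⟩ := h.cent _ hg
  exact h.iso g p hp.symm

theorem pgroup (h : Cfg ι K) (R : Subgroup H) (hR : IsPGroup 3 R) (hd : ι d0 ∈ R) :
    ∀ r ∈ R, ∃ p, ι p = r := by
  obtain ⟨S, hdS, hS⟩ := h.sylow
  obtain ⟨g, hg⟩ := conj_into_sylow S R hR
  obtain ⟨p, hp⟩ := hS _ (hg _ hd)
  have h1 := h.iso g p hp.symm
  have h1' : g * ι d0 = ι d0 * g := mul_inv_eq_iff_eq_mul.1 h1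
  intro r hr
  obtain ⟨q, hq⟩ := hS _ (hg _ hr)
  apply h.cent
  have hc : Commute (g * r * g⁻¹) (ι d0) := by rw [← hq]; exact commX q
  have hgc : Commute g (ι d0) := h1'
  have h2 := (hgc.inv_left.mul_left hc).mul_left hgc
  have h3 : g⁻¹ * (g * r * g⁻¹) * g = r := by group
  rw [h3] at h2
  exact h2

theorem cent_a (h : Cfg ι K) (g : H) (hg : g * ι a0 = ι a0 * g) : ∃ e ∈ E0, ι e = g := by
  set C : Subgroup H := centralizer {ι a0} with hC
  have hCm : ∀ x, x ∈ C ↔ x * ι a0 = ι a0 * x := fun x => mem_centralizer_singleton_iff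
  have hE3 : IsPGroup 3 (E0.map ι) := (IsPGroup.of_card (n := 3) (by rw [card_E0]; norm_num)).map ι
  have hEC : E0.map ι ≤ C := by
    rintro _ ⟨_, ⟨s, x, k, rfl⟩, rfl⟩
    rw [hCm, ← map_mul, ← map_mul]
    congr 1
    ext <;> simp [p0, a0, add_comm]
  have hXC : ∀ p, ι p ∈ C → ι p ∈ E0.map ι := by
    intro p hp
    rw [hCm] at hp
    exact ⟨p, ⟨_, _, _, comm_a p (h.comm_lift hp)⟩, rfl⟩
  have hdE : ι d0 ∈ E0.map ι := ⟨d0, ⟨1, 0, 0, rfl⟩, rfl⟩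
  have hEcomm : ∀ x ∈ E0.map ι, ∀ y ∈ E0.map ι, x * y = y * x := by
    rintro _ ⟨_, ⟨s, x, k, rfl⟩, rfl⟩ _ ⟨_, ⟨s', x', k', rfl⟩, rfl⟩
    rw [← map_mul, ← map_mul]
    congr 1
    ext <;> simp [p0, add_comm]
  obtain ⟨N, hN, hNc, hNS⟩ := burnside3 ((E0.map ι).subgroupOf C)
    (hE3.comap_of_injective C.subtype C.subtype_injective) (by
      intro R hR hle x hx
      rw [mem_subgroupOf]
      have hR' : IsPGroup 3 (R.map C.subtype) := hR.map _
      have hdR : ι d0 ∈ R.map C.subtype := ⟨⟨ι d0, hEC hdE⟩, hle (by exact hdE), rfl⟩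
      obtain ⟨p, hp⟩ := h.pgroup _ hR' hdR x ⟨x, hx, rfl⟩
      rw [← hp]
      apply hXC
      rw [hp]; exact x.2) (by
      intro g hg s hs
      have h1 : (g : H) * ι d0 * (g : H)⁻¹ ∈ E0.map ι := hg ⟨ι d0, hEC hdE⟩ hdE
      have h2 := h.iso' g (hEcomm _ h1 _ hdE)
      obtain ⟨p, hp⟩ := h.cent g (mul_inv_eq_iff_eq_mul.1 h2)
      have h3 : (g : H) ∈ E0.map ι := by rw [← hp]; apply hXC; rw [hp]; exact g.2
      exact Subtype.ext (hEcomm _ h3 _ hs))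
  have hNbot : N.map C.subtype = ⊥ := by
    apply h.sig
    · rw [Subgroup.card_map_of_injective C.subtype_injective]; exact hNc
    · rintro e he _ ⟨n, hn, rfl⟩
      exact ⟨⟨ι e, hEC ⟨e, he, rfl⟩⟩ * n * ⟨ι e, hEC ⟨e, he, rfl⟩⟩⁻¹, hN.conj_mem _ hn _, rfl⟩
  obtain ⟨n, hn, s, hs, hgns⟩ := hNS ⟨g, (hCm g).2 hg⟩
  have hn1 : (n : H) = 1 := by
    have : (n : H) ∈ N.map C.subtype := ⟨n, hn, rfl⟩
    rw [hNbot] at this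
    exact this
  have : g = s := by
    have := congrArg Subtype.val hgns
    simpa [hn1] using this
  rw [this]
  exact hs

theorem cent_q (h : Cfg ι K) (s x y : ZMod 3) (hxy : x ≠ 0 ∨ y ≠ 0) (g : H)
    (hg : g * ι (q0 s x y) = ι (q0 s x y) * g) : g * ι d0 = ι d0 * g := by
  obtain ⟨k, hk⟩ := q0_conj s x y hxy
  rw [← hk, map_mul, map_mul, map_inv] at hg
  have h1 : Commute ((ι k)⁻¹ * g * ι k) (ι a0) := by
    have : Commute g (ι k * ι a0 * (ι k)⁻¹) := hg
    have h2 := (Commute.conj_iff (ι k)⁻¹).2 this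
    rw [inv_inv] at h2
    have h3 : (ι k)⁻¹ * (ι k * ι a0 * (ι k)⁻¹) * ι k = ι a0 := by group
    rwa [h3] at h2
  obtain ⟨e, -, he⟩ := h.cent_a _ h1
  have h4 : g = ι (k * e * k⁻¹) := by
    rw [map_mul, map_mul, map_inv, he]; group
  rw [h4]
  exact commX _

end Cfg

namespace Cfg
open X0
set_option linter.unusedSectionVars false
variable {H : Type*} [Group H] [Finite H] {ι : X0 →* H} {K : Subgroup H}

theorem ed_pow (n k : ℕ) : (e0 * d0 ^ n) ^ k = d0 ^ (n * k) * e0 ^ k := by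
  have hc : Commute e0 d0 := d0_comm e0
  rw [(hc.pow_right n).mul_pow, ← pow_mul]
  exact (hc.pow_pow k (n * k)).eq

theorem comm_ed (n : ℕ) (p : X0) : p * (e0 * d0 ^ n) = (e0 * d0 ^ n) * p ↔ p * e0 = e0 * p := by
  have hc : Commute p (d0 ^ n) := (show Commute p d0 from d0_comm p).pow_right n
  constructor
  · intro h
    have h1 : Commute p (e0 * d0 ^ n) := h
    have h2 := h1.mul_right hc.inv_right
    rw [mul_inv_cancel_right] at h2
    exact h2
  · intro h
    exact (show Commute p e0 from h).mul_right hc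

theorem cent_e (h : Cfg ι K) (n : ℕ) (g : H)
    (hg : g * ι (e0 * d0 ^ n) = ι (e0 * d0 ^ n) * g) : g * ι d0 = ι d0 * g := by
  set C : Subgroup H := centralizer {ι (e0 * d0 ^ n)} with hC
  have hCm : ∀ x, x ∈ C ↔ x * ι (e0 * d0 ^ n) = ι (e0 * d0 ^ n) * x :=
    fun x => mem_centralizer_singleton_iff
  have hιC : ∀ p, ι p ∈ C ↔ p * e0 = e0 * p := by
    intro p
    rw [hCm, ← comm_ed n, ← map_mul, ← map_mul, h.inj.eq_iff]
  have haC : ι a0 ∈ C := (hιC _).2 (by decide)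
  have hdC : ι d0 ∈ C := (hιC _).2 (by decide)
  have heC : ι (e0 * d0 ^ n) ∈ C := (hCm _).2 rfl
  have hzC : ι z0 ∈ C := (hιC _).2 (by decide)
  have hEC : E0.map ι ≤ C := by
    rintro _ ⟨_, ⟨s, x, k, rfl⟩, rfl⟩
    rw [hιC]
    ext <;> simp [p0, e0, add_comm]
  have prod : ∀ i j k : ℕ, ι a0 ^ i * ι d0 ^ j * ι (e0 * d0 ^ n) ^ k =
      ι (p0 ((j + n * k : ℕ) : ZMod 3) i 0 k) := by
    intro i j k
    rw [← map_pow, ← map_pow, ← map_pow, ← map_mul, ← map_mul, ed_pow, ← mul_assoc,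
      mul_assoc (a0 ^ i), ← pow_add, pow_mem_E0]
  have res := step3 (M := C) ((E0.map ι).subgroupOf C) ⟨ι a0, haC⟩ ⟨ι d0, hdC⟩
    ⟨ι (e0 * d0 ^ n), heC⟩ ⟨ι z0, hzC⟩ ?_ ?_ ?_ ?_ ?_ ?_ ?_ ?_ ?_ ?_ ?_ ?_ ?_ ?_
  · have := res ⟨g, (hCm g).2 hg⟩
    exact congrArg Subtype.val this
  · intro x
    rw [mem_subgroupOf]
    constructor
    · rintro ⟨_, ⟨s, x', k, rfl⟩, hx⟩
      refine ⟨x'.val, s.val + 2 * (n * k.val), k.val, Subtype.ext ?_⟩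
      change (x : H) = ι a0 ^ x'.val * ι d0 ^ (s.val + 2 * (n * k.val)) * ι (e0 * d0 ^ n) ^ k.val
      rw [prod, ← hx]
      congr 1
      have h3 : (3 : ZMod 3) = 0 := by decide
      have : ((s.val + 2 * (n * k.val) + n * k.val : ℕ) : ZMod 3) = s := by
        push_cast
        rw [ZMod.natCast_zmod_val]
        linear_combination (n : ZMod 3) * (k.val : ZMod 3) * h3
      rw [this, ZMod.natCast_zmod_val, ZMod.natCast_zmod_val]
    · rintro ⟨i, j, k, rfl⟩
      change ι a0 ^ i * ι d0 ^ j * ι (e0 * d0 ^ n) ^ k ∈ E0.map ι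
      rw [prod]
      exact ⟨_, ⟨_, _, _, rfl⟩, rfl⟩
  · rw [Nat.card_congr (subgroupOfEquivOfLe hEC).toEquiv,
      Subgroup.card_map_of_injective h.inj, card_E0]
  · apply Subtype.ext
    change ι a0 ^ 3 = 1
    rw [← map_pow, a0_cube, map_one]
  · apply Subtype.ext
    exact d3
  · apply Subtype.ext
    change ι (e0 * d0 ^ n) ^ 3 = 1
    rw [← map_pow, ed_pow, mul_comm n, pow_mul, d0_cube, e0_cube, one_pow, one_mul, map_one]
  · apply Subtype.ext
    exact commX a0
  · intro i j k hijk
    have h1 : ι a0 ^ i * ι d0 ^ j * ι (e0 * d0 ^ n) ^ k = 1 := congrArg Subtype.val hijk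
    rw [prod, ← map_one ι] at h1
    have h2 := h.inj h1
    rw [p0_one] at h2
    obtain ⟨ha, hb, -, hc⟩ := p0_inj h2
    rw [ZMod.natCast_eq_zero_iff] at ha hb hc
    refine ⟨hb, ?_, hc⟩
    exact (Nat.dvd_add_left (hc.mul_left n)).1 ha
  · intro x
    apply Subtype.ext
    exact (hCm x).1 x.2
  · intro x hx
    apply Subtype.ext
    exact h.iso' x (congrArg Subtype.val hx)
  · apply Subtype.ext
    change ι z0 * ι a0 * (ι z0)⁻¹ = (ι a0)⁻¹
    rw [← map_mul, ← map_inv, ← map_mul, ← map_inv]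
    congr 1
  · intro x hx
    obtain ⟨e, he, hex⟩ := h.cent_a x (congrArg Subtype.val hx)
    exact ⟨e, he, hex⟩
  · intro i j hi x hx
    apply Subtype.ext
    have h1 : (x : H) * (ι a0 ^ i * ι d0 ^ j) = (ι a0 ^ i * ι d0 ^ j) * x := congrArg Subtype.val hx
    have h2 : ι a0 ^ i * ι d0 ^ j = ι (q0 j i 0) := by
      rw [← map_pow, ← map_pow, ← map_mul]
      congr 1
      have := pow_mem_E0 i j 0
      rw [pow_zero, mul_one] at this
      rw [this]
      simp [p0, q0]
    rw [h2] at h1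
    refine h.cent_q _ _ _ (Or.inl ?_) _ h1
    rw [ne_eq, ZMod.natCast_eq_zero_iff]
    exact hi
  · rw [← card_Ce]
    symm
    refine Nat.card_congr (Equiv.ofBijective (fun p => ⟨⟨ι p.1, (hιC _).2 p.2⟩, ?_⟩) ⟨?_, ?_⟩)
    · rw [mem_centralizer_singleton_iff]
      exact Subtype.ext (commX _)
    · intro p q hpq
      have h1 := congrArg Subtype.val (congrArg Subtype.val hpq)
      exact Subtype.ext (h.inj h1)
    · rintro ⟨⟨x, hxC⟩, hx⟩
      rw [mem_centralizer_singleton_iff] at hx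
      obtain ⟨p, rfl⟩ := h.cent x (congrArg Subtype.val hx)
      exact ⟨⟨p, (hιC _).1 hxC⟩, rfl⟩
  · rintro ⟨x, hxC⟩ hx
    obtain ⟨p, rfl⟩ := h.cent x (congrArg Subtype.val hx)
    obtain ⟨s, x, k, hp⟩ := comm_e0_sq p ((hιC _).1 hxC)
    refine ⟨p ^ 2, ⟨s, x, k, hp⟩, ?_⟩
    rw [map_pow]; rfl

theorem cent_z (h : Cfg ι K) (g : H) (hg : g * ι z0 = ι z0 * g) : g * ι d0 = ι d0 * g := by
  set C : Subgroup H := centralizer {ι z0} with hC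
  have hCm : ∀ x, x ∈ C ↔ x * ι z0 = ι z0 * x := fun x => mem_centralizer_singleton_iff
  have hιC : ∀ p, ι p ∈ C ↔ p * z0 = z0 * p := by
    intro p
    rw [hCm, ← map_mul, ← map_mul, h.inj.eq_iff]
  have hB3 : IsPGroup 3 (B0.map ι) := (IsPGroup.of_card (n := 2) (by rw [card_B0]; norm_num)).map ι
  have hBC : B0.map ι ≤ C := by
    rintro _ ⟨_, ⟨s, k, rfl⟩, rfl⟩
    rw [hιC]
    ext <;> simp [p0, z0]
  have hdB : ι d0 ∈ B0.map ι := ⟨d0, ⟨1, 0, rfl⟩, rfl⟩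
  have heB : ι e0 ∈ B0.map ι := ⟨e0, ⟨0, 1, rfl⟩, rfl⟩
  have hdC := hBC hdB
  have heC := hBC heB
  have hzC : ι z0 ∈ C := (hCm _).2 rfl
  have hBeq : ∀ b ∈ B0.map ι, ∃ i j : ℕ, b = ι d0 ^ i * ι e0 ^ j := by
    rintro _ ⟨_, ⟨s, k, rfl⟩, rfl⟩
    refine ⟨s.val, k.val, ?_⟩
    rw [p0_eq, ← map_pow, ← map_pow, ← map_mul]
    simp
  have hBcomm : ∀ x ∈ B0.map ι, ∀ y ∈ B0.map ι, x * y = y * x := by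
    rintro _ ⟨_, ⟨s, k, rfl⟩, rfl⟩ _ ⟨_, ⟨s', k', rfl⟩, rfl⟩
    rw [← map_mul, ← map_mul]
    congr 1
    ext <;> simp [p0, add_comm]
  have hk0 : ∀ p, p * z0 = z0 * p → p = q0 p.s 0 0 * k0 p := by
    intro p hp
    obtain ⟨h1, h2⟩ := comm_z0 p hp
    conv_lhs => rw [← q0_mul_k0 p, h1, h2]
  -- 3-elements of C ∩ X together with B
  obtain ⟨W, hW, hWc, hWS⟩ := burnside3 ((B0.map ι).subgroupOf C)
    (hB3.comap_of_injective C.subtype C.subtype_injective) (by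
      intro R hR hle
      -- R is a 3-subgroup of C ∩ X, of order dividing 72
      have hR' : IsPGroup 3 (R.map C.subtype) := hR.map _
      have hdR : ι d0 ∈ R.map C.subtype := ⟨⟨ι d0, hdC⟩, hle (by exact hdB), rfl⟩
      have hRX := h.pgroup _ hR' hdR
      let R0 : Subgroup X0 := (R.map C.subtype).comap ι
      have hR0c : R0 ≤ centralizer {z0} := by
        rintro p ⟨r, hr, hrp⟩
        rw [mem_centralizer_singleton_iff]
        apply (hιC p).1
        rw [← hrp]; exact r.2
      have hcard : Nat.card (centralizer {z0} : Subgroup X0) = 72 := by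
        rw [← card_Cz]
        exact Nat.card_congr (Equiv.subtypeEquivRight fun p => mem_centralizer_singleton_iff)
      have hdvd : Nat.card R0 ∣ 72 := by rw [← hcard]; exact Subgroup.card_dvd_of_le hR0c
      have hR0p : IsPGroup 3 R0 := hR'.comap_of_injective ι h.inj
      have : Fact (Nat.Prime 3) := ⟨by norm_num⟩
      obtain ⟨m, hm⟩ := hR0p.exists_card_eq
      have hm2 : m ≤ 2 := by
        rw [hm] at hdvd
        by_contra! hm3
        have : 3 ^ 3 ∣ 72 := (pow_dvd_pow 3 hm3).trans hdvd
        omega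
      have hB0 : B0 ≤ R0 := by
        intro b hb
        exact ⟨⟨ι b, hBC ⟨b, hb, rfl⟩⟩, hle (show ι b ∈ B0.map ι from ⟨b, hb, rfl⟩), rfl⟩
      have heq : B0 = R0 := by
        apply Subgroup.eq_of_le_of_card_ge hB0
        rw [card_B0, hm]
        calc 3 ^ m ≤ 3 ^ 2 := Nat.pow_le_pow_right (by norm_num) hm2
          _ = 9 := by norm_num
      intro x hx
      rw [mem_subgroupOf]
      obtain ⟨p, hp⟩ := hRX x ⟨x, hx, rfl⟩
      refine ⟨p, ?_, hp⟩
      rw [heq]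
      exact ⟨x, hx, hp.symm⟩) (by
      intro g hg s hs
      have h1 : (g : H) * ι d0 * (g : H)⁻¹ ∈ B0.map ι := hg ⟨ι d0, hdC⟩ hdB
      have h2 := h.iso' g (hBcomm _ h1 _ hdB)
      have h1' : (g : H) * ι e0 * (g : H)⁻¹ ∈ B0.map ι := hg ⟨ι e0, heC⟩ heB
      obtain ⟨p, hp⟩ := h.cent g (mul_inv_eq_iff_eq_mul.1 h2)
      have hpz : p * z0 = z0 * p := (hιC p).1 (by rw [hp]; exact g.2)
      have hpe : p * e0 = e0 * p := by
        obtain ⟨i, j, hij⟩ := hBeq _ h1'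
        rw [← hp, ← map_pow, ← map_pow, ← map_mul, ← map_inv, ← map_mul, ← map_mul] at hij
        have h3 := h.inj hij
        rw [mul_inv_eq_iff_eq_mul] at h3
        have h4 := congrArg k0 h3
        have kk : k0 e0 = e0 := rfl
        have kd : k0 d0 = 1 := rfl
        rw [k0_mul, k0_mul, k0_mul, k0_pow, k0_pow, kk, kd, one_pow, one_mul] at h4
        have h5 := norm_e0 p j h4
        rw [hk0 p hpz, q0_eq_d0]
        have hd : Commute (d0 ^ p.s.val) e0 := (show Commute e0 d0 from d0_comm e0).symm.pow_left _
        exact hd.mul_left h5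
      obtain ⟨i, j, hij⟩ := hBeq _ hs
      apply Subtype.ext
      change (g : H) * (s : H) = s * g
      have hsH : (s : H) = ι d0 ^ i * ι e0 ^ j := hij
      rw [hsH, ← hp]
      have c1 : Commute (ι p) (ι d0) := commX p
      have c2 : Commute (ι p) (ι e0) := by
        change ι p * ι e0 = ι e0 * ι p
        rw [← map_mul, hpe, map_mul]
      exact (c1.pow_right i).mul_right (c2.pow_right j))
  have hWd := core4' W hW hWc ⟨ι d0, hdC⟩ ⟨ι e0, heC⟩ ⟨ι z0, hzC⟩
    (Subtype.ext (hBcomm _ hdB _ heB)) (Subtype.ext d3)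
    (Subtype.ext (show ι e0 ^ 3 = 1 by rw [← map_pow, e0_cube, map_one]))
    (fun x => Subtype.ext ((hCm x).1 x.2))
    (Subtype.ext (show ι z0 ^ 2 = 1 by rw [← map_pow, z0_sq, map_one])) (by
      rintro n ⟨w, hwC⟩ hw hcomm
      have h1 : w * (ι e0 * ι d0 ^ n) = (ι e0 * ι d0 ^ n) * w := congrArg Subtype.val hcomm
      rw [← map_pow, ← map_mul] at h1
      obtain ⟨p, rfl⟩ := h.cent w (h.cent_e n w h1)
      have hpz := (hιC p).1 hwC
      have hpe := (comm_ed n p).1 (h.comm_lift h1)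
      obtain ⟨s, x, k, hp2⟩ := comm_e0_sq p hpe
      -- p^2 has order dividing three
      have h3 : (p ^ 2) ^ 3 = 1 := by
        rw [hp2, p0_eq]
        have ha : Commute a0 d0 := d0_comm a0
        have he : Commute e0 d0 := d0_comm e0
        have hae : Commute a0 e0 := by change a0 * e0 = e0 * a0; decide
        rw [(((hae.pow_pow _ _)).mul_left (he.symm.pow_pow _ _)).mul_pow, (ha.pow_pow _ _).mul_pow,
          ← pow_mul, ← pow_mul, ← pow_mul, mul_comm _ 3, mul_comm _ 3, mul_comm _ 3, pow_mul,
          pow_mul, pow_mul, a0_cube, d0_cube, e0_cube]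
        simp
      have h4 : (⟨ι p, hwC⟩ : C) ^ 2 = 1 := by
        apply eq_one_of_coprime3 W hWc _ (W.pow_mem hw 2)
        apply Subtype.ext
        change ((ι p) ^ 2) ^ 3 = 1
        rw [← map_pow, ← map_pow, h3, map_one]
      have h5 : p ^ 2 = 1 := by
        apply h.inj
        rw [map_pow, map_one]
        exact congrArg Subtype.val h4
      by_cases hp1 : p = 1
      · left; apply Subtype.ext
        change ι p = 1
        rw [hp1, map_one]
      · right; apply Subtype.ext
        change ι p = ι z0
        have h6 := invol p h5 hp1
        obtain ⟨hx, hy⟩ := comm_z0 p hpz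
        rw [h6]
        simp only [hx, hy]
        rfl)
  obtain ⟨w, hw, s, hs, hgws⟩ := hWS ⟨g, (hCm g).2 hg⟩
  have hg' : g = w * s := congrArg Subtype.val hgws
  have c1 : Commute (w : H) (ι d0) := congrArg Subtype.val (hWd w hw)
  have c2 : Commute (s : H) (ι d0) := hBcomm _ hs _ hdB
  rw [hg']
  exact c1.mul_left c2

theorem cent_invol (h : Cfg ι K) (p : X0) (h2 : p ^ 2 = 1) (h1 : p ≠ 1) (g : H)
    (hg : g * ι p = ι p * g) : g * ι d0 = ι d0 * g := by
  obtain ⟨k, hk⟩ := invol_conj p.x p.y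
  rw [← invol p h2 h1] at hk
  rw [← hk, map_mul, map_mul, map_inv] at hg
  have h1 : Commute ((ι k)⁻¹ * g * ι k) (ι z0) := by
    have : Commute g (ι k * ι z0 * (ι k)⁻¹) := hg
    have h2 := (Commute.conj_iff (ι k)⁻¹).2 this
    rw [inv_inv] at h2
    have h3 : (ι k)⁻¹ * (ι k * ι z0 * (ι k)⁻¹) * ι k = ι z0 := by group
    rwa [h3] at h2
  obtain ⟨e, he⟩ := h.cent _ (h.cent_z _ h1)
  have h4 : g = ι (k * e * k⁻¹) := by
    rw [map_mul, map_mul, map_inv, he]; group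
  rw [h4]
  exact commX _

/-- an element inverting a nontrivial element of `K ∩ X` lies in `X` -/
theorem inverts (h : Cfg ι K) (t : H) (p : X0) (hp : InY p) (hp1 : p ≠ 1)
    (ht : t * ι p * t⁻¹ = (ι p)⁻¹) : t * ι d0 = ι d0 * t := by
  have hpow : ∀ n : ℕ, t * ι (p ^ n) * t⁻¹ = (ι (p ^ n))⁻¹ := by
    intro n
    rw [map_pow, ← conj_pow, ht, inv_pow]
  have hinv : ∀ n : ℕ, (p ^ n) ^ 2 = 1 → p ^ n ≠ 1 → t * ι d0 = ι d0 * t := by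
    intro n h2 h1
    refine h.cent_invol (p ^ n) h2 h1 t ?_
    have h3 := hpow n
    have h4 : (p ^ n)⁻¹ = p ^ n := by rw [inv_eq_iff_mul_eq_one, ← pow_two, h2]
    rw [← map_inv, h4] at h3
    exact mul_inv_eq_iff_eq_mul.1 h3
  have h12 := inY_pow12 p hp
  by_cases h6 : p ^ 6 = 1
  · by_cases h3 : p ^ 3 = 1
    · have hq := inY_cube p hp h3
      by_cases hxy : p.x ≠ 0 ∨ p.y ≠ 0
      · -- t normalizes the centralizer of p
        rw [hq] at ht
        have hc : Commute (t * ι d0 * t⁻¹) (ι (q0 p.s p.x p.y)) := by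
          have c1 : Commute (ι d0) (ι (q0 p.s p.x p.y)) := (commX _).symm
          have c2 := (Commute.conj_iff t).2 c1
          rw [ht] at c2
          simpa using c2.inv_right
        have := h.cent_q _ _ _ hxy _ hc
        exact mul_inv_eq_iff_eq_mul.1 (h.iso' t this)
      · exfalso
        push Not at hxy
        rw [hxy.1, hxy.2] at hq
        generalize p.s = s at hq
        have hs : s = 0 ∨ s = 1 ∨ s = 2 := by clear * -; revert s; decide
        rcases hs with rfl | rfl | rfl
        · exact hp1 hq
        · rw [hq] at ht
          exact h.nc t ht
        · rw [hq, show q0 2 0 0 = d0⁻¹ by decide, map_inv, inv_inv] at ht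
          apply h.nc t
          have := congrArg (·⁻¹) ht
          simp only [mul_inv_rev, inv_inv] at this
          rw [← this]; group
    · exact hinv 3 (by rw [← pow_mul]; exact h6) h3
  · exact hinv 6 (by rw [← pow_mul]; exact h12) h6

theorem final (h : Cfg ι K) (g : H) : g * ι d0 = ι d0 * g := by
  classical
  have := h.knorm
  set X : Subgroup H := ι.range with hX
  have hXm : ∀ g, g ∈ X ↔ g * ι d0 = ι d0 * g := by
    intro g
    constructor
    · rintro ⟨p, rfl⟩; exact commX p
    · intro hg; exact h.cent g hg
  have hXcard : Nat.card X = 648 := by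
    rw [← card_X0]
    exact Nat.card_congr (MonoidHom.ofInjective h.inj).toEquiv.symm
  set I : Set H := {x | IsConj (ι z0) x} with hI
  have hCz : Nat.card (centralizer {ι z0} : Subgroup H) = 72 := by
    rw [← card_Cz]
    symm
    refine Nat.card_congr (Equiv.ofBijective (fun p => ⟨ι p.1, ?_⟩) ⟨?_, ?_⟩)
    · rw [mem_centralizer_singleton_iff, ← map_mul, p.2, map_mul]
    · intro p q hpq
      exact Subtype.ext (h.inj (congrArg Subtype.val hpq))
    · rintro ⟨x, hx⟩
      rw [mem_centralizer_singleton_iff] at hx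
      obtain ⟨p, rfl⟩ := h.cent x (h.cent_z x hx)
      exact ⟨⟨p, h.comm_lift hx⟩, rfl⟩
  have hIcard : I.ncard * 72 = X.index * 648 := by
    rw [← hCz, ← hXcard, X.index_mul_card, ← card_conj_mul (ι z0), ← Nat.card_coe_set_eq]
    rfl
  have hI2 : ∀ x ∈ I, x ^ 2 = 1 ∧ x ≠ 1 ∧ x ∈ K := by
    intro x hx
    obtain ⟨c, rfl⟩ := isConj_iff.1 hx
    refine ⟨?_, ?_, ?_⟩
    · rw [conj_pow, ← map_pow, z0_sq, map_one]; simp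
    · intro h1
      rw [mul_inv_eq_one, mul_eq_left, ← map_one ι] at h1
      exact absurd (h.inj h1) (by decide)
    · exact h.knorm.conj_mem _ ((h.mem_K_iff z0).2 (Or.inl (by decide))) c
  have hIn : (I ∩ X).ncard ≤ 9 := by
    have h1 : (I ∩ X) ⊆ (fun q : ZMod 3 × ZMod 3 =>
        ι ⟨0, q.1, q.2, -1, 0, 0, -1, by decide⟩) '' Set.univ := by
      rintro _ ⟨hx, p, rfl⟩
      obtain ⟨h2, h1, -⟩ := hI2 _ hx
      have h3 := invol p (by apply h.inj; rw [map_pow, h2, map_one])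
        (by rintro rfl; exact h1 (map_one ι))
      refine ⟨(p.x, p.y), trivial, ?_⟩
      change ι _ = ι p
      rw [h3]
    refine (Set.ncard_le_ncard h1).trans ((Set.ncard_image_le).trans ?_)
    rw [Set.ncard_univ, Nat.card_prod, Nat.card_zmod]
  have hOut : (I \ X).ncard ≤ X.index - 1 := by
    have h1 : ({(1 : H)} : Set H).ncard = 1 := Set.ncard_singleton _
    have h2 : ({c : H ⧸ X | c ≠ ((1 : H) : H ⧸ X)}).ncard = X.index - 1 := by
      have : {c : H ⧸ X | c ≠ ((1 : H) : H ⧸ X)} = {((1 : H) : H ⧸ X)}ᶜ := rfl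
      rw [this, Set.ncard_compl, Set.ncard_singleton]
      rfl
    rw [← h2]
    refine Set.ncard_le_ncard_of_injOn (fun x => (x : H ⧸ X)) ?_ ?_
    · rintro x ⟨-, hx⟩ h3
      apply hx
      have h3 : (x : H ⧸ X) = ((1 : H) : H ⧸ X) := h3
      rw [QuotientGroup.eq, mul_one] at h3
      exact (X.inv_mem_iff).1 h3
    · rintro s ⟨hs, hsX⟩ t ⟨ht, htX⟩ hst
      by_contra hne
      have hst : (s : H ⧸ X) = (t : H ⧸ X) := hst
      rw [QuotientGroup.eq] at hst
      obtain ⟨hs2, -, hsK⟩ := hI2 s hs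
      obtain ⟨ht2, -, htK⟩ := hI2 t ht
      obtain ⟨p, hp⟩ := hst
      apply htX
      rw [SetLike.mem_coe, hXm]
      refine h.inverts t p ((h.mem_K_iff p).1 ?_) ?_ ?_
      · rw [hp]; exact K.mul_mem (K.inv_mem hsK) htK
      · rintro rfl
        rw [map_one] at hp
        exact hne (inv_mul_eq_one.1 hp.symm)
      · have hsi : s⁻¹ = s := by rw [inv_eq_iff_mul_eq_one, ← pow_two, hs2]
        have hti : t⁻¹ = t := by rw [inv_eq_iff_mul_eq_one, ← pow_two, ht2]
        rw [hp, mul_inv_rev, inv_inv, hsi, hti, mul_assoc, mul_assoc, ← pow_two, ht2, mul_one]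
  have hsplit : I.ncard = (I ∩ X).ncard + (I \ X).ncard :=
    (Set.ncard_inter_add_ncard_sdiff_eq_ncard I (X : Set H)).symm
  have hidx : X.index = 1 := by
    have : X.index ≠ 0 := Subgroup.index_ne_zero_of_finite
    omega
  rw [← hXm, Subgroup.index_eq_one.1 hidx]
  trivial

end Cfg

namespace X0

/-- the matrix of an element -/
def jm (p : X0) : Matrix (Fin 2 ⊕ Fin 2) (Fin 2 ⊕ Fin 2) (ZMod 3) :=
  Matrix.fromBlocks !![1, p.x * p.c - p.y * p.a; 0, p.a] !![p.s, p.x * p.d - p.y * p.b; p.x, p.b]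
    !![0, 0; 0, p.c] !![1, 0; p.y, p.d]

theorem jm_mul (p q : X0) : jm (p * q) = jm p * jm q := by
  have h := p.det
  unfold jm
  rw [Matrix.fromBlocks_multiply]
  congr 1 <;> ext i j <;> fin_cases i <;> fin_cases j <;> simp <;> try ring1
  · linear_combination (q.x * q.c - q.y * q.a) * h
  · linear_combination (q.x * q.d - q.y * q.b) * h

theorem jm_one : jm 1 = 1 := by
  decide

theorem jm_mem (p : X0) : jm p ∈ Matrix.symplecticGroup (Fin 2) (ZMod 3) := by
  have h := p.det
  rw [SymplecticGroup.mem_iff]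
  ext (i | i) (j | j) <;> fin_cases i <;> fin_cases j <;>
    simp [jm, Matrix.J, Matrix.mul_apply, Fin.sum_univ_two] <;>
    first | ring1 | linear_combination h | linear_combination -h | linear_combination p.x * h |
      linear_combination -p.x * h | linear_combination p.y * h | linear_combination -p.y * h

theorem jm_inj {p q : X0} (h : jm p = jm q) : p = q := by
  have e := fun i j => congrFun (congrFun h i) j
  have e1 := e (Sum.inl 0) (Sum.inr 0)
  have e2 := e (Sum.inl 1) (Sum.inr 0)
  have e3 := e (Sum.inr 1) (Sum.inr 0)
  have e4 := e (Sum.inl 1) (Sum.inl 1)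
  have e5 := e (Sum.inl 1) (Sum.inr 1)
  have e6 := e (Sum.inr 1) (Sum.inl 1)
  have e7 := e (Sum.inr 1) (Sum.inr 1)
  simp [jm] at *
  ext <;> assumption

/-- the embedding in the symplectic group -/
def j : X0 →* Sp4F3 where
  toFun p := ⟨jm p, jm_mem p⟩
  map_one' := Subtype.ext jm_one
  map_mul' p q := Subtype.ext (jm_mul p q)

/-- a symplectic matrix commuting with `d0` and with first entry one -/
theorem comm_d0_sp1 (A : Matrix (Fin 2 ⊕ Fin 2) (Fin 2 ⊕ Fin 2) (ZMod 3))
    (hA : A ∈ Matrix.symplecticGroup (Fin 2) (ZMod 3)) (h : A * jm d0 = jm d0 * A)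
    (h1 : A (Sum.inl 0) (Sum.inl 0) = 1) : ∃ p, A = jm p := by
  rw [SymplecticGroup.mem_iff] at hA
  have e := fun i j => congrFun (congrFun hA i) j
  have f := fun i j => congrFun (congrFun h i) j
  simp [jm, d0, Matrix.J, Matrix.mul_apply, Fin.sum_univ_two] at e f
  obtain ⟨⟨⟨⟨f1, f2⟩, f3, f4⟩, f5⟩, -, f6⟩ := f
  obtain ⟨⟨⟨⟨-, e1⟩, -, e2⟩, ⟨-, -⟩, -, e3⟩, -⟩ := e
  have f7 : A (Sum.inr 0) (Sum.inr 0) = 1 := by rw [h1] at f3; linear_combination -f3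
  simp only [h1, f5, f6, one_mul, mul_zero, zero_mul, neg_zero, zero_add] at e1 e2 e3
  have hdet : A (Sum.inl 1) (Sum.inl 1) * A (Sum.inr 1) (Sum.inr 1) -
      A (Sum.inl 1) (Sum.inr 1) * A (Sum.inr 1) (Sum.inl 1) = 1 := by
    linear_combination -e3
  refine ⟨⟨A (Sum.inl 0) (Sum.inr 0), A (Sum.inl 1) (Sum.inr 0), A (Sum.inr 1) (Sum.inr 0),
    A (Sum.inl 1) (Sum.inl 1), A (Sum.inl 1) (Sum.inr 1), A (Sum.inr 1) (Sum.inl 1),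
    A (Sum.inr 1) (Sum.inr 1), hdet⟩, ?_⟩
  ext (i | i) (j | j) <;> fin_cases i <;> fin_cases j <;> simp [jm, *]
  · linear_combination -A (Sum.inl 0) (Sum.inl 1) * hdet + A (Sum.inr 1) (Sum.inl 1) * e1
      - A (Sum.inl 1) (Sum.inl 1) * e2
  · linear_combination -A (Sum.inl 0) (Sum.inr 1) * hdet + A (Sum.inr 1) (Sum.inr 1) * e1
      - A (Sum.inl 1) (Sum.inr 1) * e2

theorem comm_d0_sp (A : Matrix (Fin 2 ⊕ Fin 2) (Fin 2 ⊕ Fin 2) (ZMod 3))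
    (hA : A ∈ Matrix.symplecticGroup (Fin 2) (ZMod 3)) (h : A * jm d0 = jm d0 * A) :
    ∃ p, A = jm p ∨ A = - jm p := by
  have hpm : A (Sum.inl 0) (Sum.inl 0) = 1 ∨ A (Sum.inl 0) (Sum.inl 0) = -1 := by
    rw [SymplecticGroup.mem_iff] at hA
    have e := fun i j => congrFun (congrFun hA i) j
    have f := fun i j => congrFun (congrFun h i) j
    simp [jm, d0, Matrix.J, Matrix.mul_apply, Fin.sum_univ_two] at e f
    obtain ⟨⟨⟨⟨f1, f2⟩, f3, f4⟩, f5⟩, -, f6⟩ := f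
    obtain ⟨⟨⟨⟨-, -⟩, e1, -⟩, -⟩, -⟩ := e
    have f7 : A (Sum.inr 0) (Sum.inr 0) = A (Sum.inl 0) (Sum.inl 0) := by linear_combination -f3
    simp only [f1, f2, f4, f7, mul_zero, neg_zero, zero_add, add_zero] at e1
    generalize A (Sum.inl 0) (Sum.inl 0) = t at e1
    clear f7 f3
    revert t
    decide
  rcases hpm with h1 | h1
  · obtain ⟨p, hp⟩ := comm_d0_sp1 A hA h h1
    exact ⟨p, Or.inl hp⟩
  · obtain ⟨p, hp⟩ := comm_d0_sp1 (-A) (SymplecticGroup.neg_mem hA)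
      (by rw [neg_mul, h, mul_neg]) (by simp [h1])
    exact ⟨p, Or.inr (by rw [← hp, neg_neg])⟩

/-- an element `±j p` commuting with `j r` -/
theorem comm_of_sp (A : Matrix (Fin 2 ⊕ Fin 2) (Fin 2 ⊕ Fin 2) (ZMod 3)) (p r : X0)
    (hp : A = jm p ∨ A = - jm p) (h : A * jm r = jm r * A) : p * r = r * p := by
  apply jm_inj
  rw [jm_mul, jm_mul]
  rcases hp with rfl | rfl
  · exact h
  · simpa using h

theorem center_sp (c : Sp4F3) (hc : c ∈ center Sp4F3) : c.1 = 1 ∨ c.1 = -1 := by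
  rw [mem_center_iff] at hc
  have hc' : ∀ g : Sp4F3, c.1 * g.1 = g.1 * c.1 := fun g => (congrArg Subtype.val (hc g)).symm
  obtain ⟨p, hp⟩ := comm_d0_sp c.1 c.2 (hc' (j d0))
  have ha := comm_of_sp _ p a0 hp (hc' (j a0))
  have hb := comm_of_sp _ p b0 hp (hc' (j b0))
  have hq := comm_ab p ha hb
  have hJ := hc' (SymplecticGroup.symJ (Fin 2) (ZMod 3))
  have hJ' : jm p * Matrix.J (Fin 2) (ZMod 3) = Matrix.J (Fin 2) (ZMod 3) * jm p := by
    rcases hp with hp | hp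
    · rw [hp] at hJ; exact hJ
    · rw [hp] at hJ; simpa using hJ
  have hs : p.s = 0 := by
    have := congrFun (congrFun hJ' (Sum.inl 0)) (Sum.inl 0)
    rw [hq] at this
    simpa [jm, q0, Matrix.J, Matrix.mul_apply, Fin.sum_univ_two] using this
  rw [hs] at hq
  have : jm p = 1 := by rw [hq]; exact jm_one
  rwa [this] at hp

/-- the embedding in the projective group -/
def φ : X0 →* PSp4F3 := (QuotientGroup.mk' (center Sp4F3)).comp j

theorem φ_inj : Function.Injective φ := by
  rw [injective_iff_map_eq_one]
  intro p hp
  have h1 : j p ∈ center Sp4F3 := (QuotientGroup.eq_one_iff _).1 hp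
  rcases center_sp _ h1 with h | h
  · exact jm_inj (h.trans jm_one.symm)
  · have := congrFun (congrFun h (Sum.inl 0)) (Sum.inl 0)
    change jm p (Sum.inl 0) (Sum.inl 0) = _ at this
    simp [jm] at this
    exact absurd this (by decide)

/-- commuting in the projective group with a unipotent element -/
theorem lift_comm (A : Sp4F3) (r : X0) (hr : Matrix.trace (jm r) = 1)
    (h : (A : PSp4F3) * φ r = φ r * (A : PSp4F3)) : A.1 * jm r = jm r * A.1 := by
  have h1 : ((j r * A : Sp4F3) : PSp4F3) = ((A * j r : Sp4F3) : PSp4F3) := h.symm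
  rw [QuotientGroup.eq] at h1
  obtain ⟨c, hc, hcc⟩ : ∃ c ∈ center Sp4F3, A * j r = j r * A * c := ⟨_, h1, by group⟩
  have hm : A.1 * jm r = jm r * A.1 * c.1 := congrArg Subtype.val hcc
  rcases center_sp c hc with h | h
  · rw [h, mul_one] at hm; exact hm
  · exfalso
    rw [h] at hm
    have hi : A.1 * (A⁻¹).1 = 1 := congrArg Subtype.val (mul_inv_cancel A)
    have hi' : (A⁻¹).1 * A.1 = 1 := congrArg Subtype.val (inv_mul_cancel A)
    have h2 : jm r = - ((A⁻¹).1 * (jm r * A.1)) := by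
      calc jm r = (A⁻¹).1 * (A.1 * jm r) := by rw [← mul_assoc, hi', one_mul]
        _ = _ := by rw [hm]; simp
    have h3 := congrArg Matrix.trace h2
    rw [Matrix.trace_neg, Matrix.trace_mul_comm, mul_assoc, hi, mul_one, hr] at h3
    exact absurd h3 (by decide)

theorem comm_φ_d0 (w : PSp4F3) (h : w * φ d0 = φ d0 * w) : ∃ p, φ p = w := by
  induction w using QuotientGroup.induction_on with
  | H A =>
    obtain ⟨p, hp⟩ := comm_d0_sp A.1 A.2 (lift_comm A d0 (by decide) h)
    refine ⟨p, ?_⟩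
    rcases hp with hp | hp
    · exact congrArg _ (Subtype.ext hp.symm : j p = A)
    · change ((j p : Sp4F3) : PSp4F3) = (A : PSp4F3)
      rw [QuotientGroup.eq, mem_center_iff]
      have h1 : ((j p)⁻¹ * A : Sp4F3).1 = -1 := by
        have : A.1 = (j p).1 * (-1) := by rw [hp, mul_neg, mul_one]; rfl
        change ((j p)⁻¹).1 * A.1 = -1
        have hi' : ((j p)⁻¹).1 * (j p).1 = 1 := congrArg Subtype.val (inv_mul_cancel (j p))
        rw [this, ← mul_assoc, hi', one_mul]
      intro g
      apply Subtype.ext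
      change g.1 * ((j p)⁻¹ * A : Sp4F3).1 = ((j p)⁻¹ * A : Sp4F3).1 * g.1
      rw [h1]; simp

theorem P0_pgroup : IsPGroup 3 P0 := IsPGroup.of_card (n := 4) (by rw [card_P0]; norm_num)

/-- a nontrivial 3-central element is conjugate to the standard one or to its inverse -/
theorem central_conj (z : PSp4F3) (hz1 : z ≠ 1) (hz : IsThreeCentral z) :
    ∃ g : PSp4F3, g⁻¹ * z * g = φ d0 ∨ g⁻¹ * z * g = (φ d0)⁻¹ := by
  obtain ⟨-, T, -, hT⟩ := hz
  obtain ⟨g, hg⟩ := conj_into_sylow T (P0.map φ) (P0_pgroup.map φ)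
  refine ⟨g, ?_⟩
  have hc : ∀ r ∈ P0, (g⁻¹ * z * g) * φ r = φ r * (g⁻¹ * z * g) := by
    intro r hr
    have := hT _ (hg (φ r) ⟨r, hr, rfl⟩)
    calc (g⁻¹ * z * g) * φ r = g⁻¹ * (z * (g * φ r * g⁻¹)) * g := by group
      _ = _ := by rw [this]; group
  obtain ⟨p, hp⟩ := comm_φ_d0 _ (hc d0 ⟨1, 0, 0, 0, by decide⟩)
  rw [← hp] at hc
  have ha : p * a0 = a0 * p := φ_inj (by
    rw [map_mul, map_mul]; exact hc a0 ⟨0, 1, 0, 0, by decide⟩)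
  have hb : p * b0 = b0 * p := φ_inj (by
    rw [map_mul, map_mul]; exact hc b0 ⟨0, 0, 1, 0, by decide⟩)
  have hq := comm_ab p ha hb
  have hs : p.s = 0 ∨ p.s = 1 ∨ p.s = -1 := by generalize p.s = s; revert s; decide
  rw [← hp]
  rcases hs with hs | hs | hs
  · exfalso
    rw [hs] at hq
    have h1 : p = 1 := hq
    rw [h1, map_one] at hp
    apply hz1
    calc z = g * (g⁻¹ * z * g) * g⁻¹ := by group
      _ = 1 := by rw [← hp]; group
  · left; rw [hq, hs]; rfl
  · right; rw [hq, hs, ← map_inv]; congr 1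

theorem comm_inv_iff {G : Type*} [Group G] (a g : G) : g * a⁻¹ = a⁻¹ * g ↔ g * a = a * g :=
  (Commute.inv_right_iff (a := g) (b := a))

theorem equiv_centralizer (z : PSp4F3) (hz1 : z ≠ 1) (hz : IsThreeCentral z) :
    Nonempty (X0 ≃* (centralizer {z} : Subgroup PSp4F3)) := by
  obtain ⟨g, hg⟩ := central_conj z hz1 hz
  have key : ∀ w, w ∈ centralizer {z} ↔ (g⁻¹ * w * g) * φ d0 = φ d0 * (g⁻¹ * w * g) := by
    intro w
    have h1 : w ∈ centralizer {z} ↔ (g⁻¹ * w * g) * (g⁻¹ * z * g) = (g⁻¹ * z * g) * (g⁻¹ * w * g) := by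
      rw [mem_centralizer_singleton_iff]
      constructor
      · intro h
        calc (g⁻¹ * w * g) * (g⁻¹ * z * g) = g⁻¹ * (w * z) * g := by group
          _ = _ := by rw [h]; group
      · intro h
        calc w * z = g * ((g⁻¹ * w * g) * (g⁻¹ * z * g)) * g⁻¹ := by group
          _ = _ := by rw [h]; group
    rw [h1]
    rcases hg with hg | hg
    · rw [hg]
    · rw [hg, comm_inv_iff]
  let ψ : X0 →* PSp4F3 := (MulAut.conj g).toMonoidHom.comp φ
  have hψ : ∀ p, ψ p = g * φ p * g⁻¹ := fun p => rfl
  refine ⟨MulEquiv.ofBijective (ψ.codRestrict _ ?_) ⟨?_, ?_⟩⟩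
  · intro p
    rw [key, hψ]
    have : g⁻¹ * (g * φ p * g⁻¹) * g = φ p := by group
    rw [this, ← map_mul, ← map_mul, d0_comm]
  · intro p q hpq
    have h1 : ψ p = ψ q := congrArg Subtype.val hpq
    rw [hψ, hψ] at h1
    exact φ_inj (mul_left_cancel (mul_right_cancel h1))
  · rintro ⟨w, hw⟩
    obtain ⟨p, hp⟩ := comm_φ_d0 _ ((key w).1 hw)
    refine ⟨p, Subtype.ext ?_⟩
    change ψ p = w
    rw [hψ, hp]; group

end X0

namespace X0

theorem abel27 (R : Subgroup X0) (hR : R ≤ P0) (hc : Nat.card R = 27)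
    (hab : ∀ a ∈ R, ∀ b ∈ R, a * b = b * a) : R = E0 := by
  have hle : R ≤ E0 := by
    intro r hr
    obtain ⟨s, x, y, k, rfl⟩ := hR hr
    by_cases hy : y = 0
    · subst hy; exact ⟨s, x, k, rfl⟩
    exfalso
    have hyy : y * y = 1 := by clear hr; revert y; decide
    have key : ∀ s' x' y' k', p0 s' x' y' k' ∈ R → k' = k * y' * y ∧
        x' = y * (x * y' + k * y * y' - k' * y * y') := by
      intro s' x' y' k' h
      have h1 := hab _ hr _ h
      rw [p0_mul, p0_mul] at h1
      obtain ⟨h1, h2, -, -⟩ := p0_inj h1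
      have h3 : (3 : ZMod 3) = 0 := by decide
      constructor
      · linear_combination -k' * hyy - y * h2
      · linear_combination (-x') * hyy + y * h1 + (-y * (x * y' - x' * y)) * h3
    let F : R → ZMod 3 × ZMod 3 := fun t => (t.1.s, t.1.y)
    have hF : Function.Injective F := by
      rintro ⟨t, ht⟩ ⟨u, hu⟩ h
      obtain ⟨s1, x1, y1, k1, rfl⟩ := hR ht
      obtain ⟨s2, x2, y2, k2, rfl⟩ := hR hu
      have h1 : s1 = s2 := congrArg Prod.fst h
      have h2 : y1 = y2 := congrArg Prod.snd h
      subst h1 h2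
      obtain ⟨ka, xa⟩ := key _ _ _ _ ht
      obtain ⟨kb, xb⟩ := key _ _ _ _ hu
      have hk : k1 = k2 := ka.trans kb.symm
      subst hk
      have hx : x1 = x2 := xa.trans xb.symm
      subst hx
      rfl
    have := Nat.card_le_card_of_injective F hF
    rw [hc] at this
    simp at this
  exact Subgroup.eq_of_le_of_card_ge hle (by rw [hc, card_E0])

theorem exists_conj_E0 (R : Subgroup X0) (hc : Nat.card R = 27)
    (hab : ∀ a ∈ R, ∀ b ∈ R, a * b = b * a) : ∃ g : X0, ∀ r ∈ R, g * r * g⁻¹ ∈ E0 := by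
  have hidx : ¬ 3 ∣ P0.index := by
    have := P0.card_mul_index
    rw [card_P0, card_X0] at this
    omega
  obtain ⟨g, hg⟩ := conj_into_sylow (P0_pgroup.toSylow hidx) R
    (IsPGroup.of_card (n := 3) (by rw [hc]; norm_num))
  refine ⟨g, ?_⟩
  have h1 : R.map (MulAut.conj g).toMonoidHom = E0 := by
    apply abel27
    · rintro _ ⟨r, hr, rfl⟩
      exact hg r hr
    · rw [Subgroup.card_map_of_injective (MulAut.conj g).injective, hc]
    · rintro _ ⟨a, ha, rfl⟩ _ ⟨b, hb, rfl⟩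
      rw [← map_mul, hab a ha b hb, map_mul]
  intro r hr
  rw [← h1]
  exact ⟨r, hr, rfl⟩

end X0

open X0

theorem stmt3    {H : Type*} [Group H] [Fintype H] (d : H) (hd : orderOf d = 3)
    (hX : ∃ z : PSp4F3, z ≠ 1 ∧ IsThreeCentral z ∧
      Nonempty ((Subgroup.centralizer {d} : Subgroup H) ≃*
        (Subgroup.centralizer {z} : Subgroup PSp4F3)))
    (P : Subgroup H) (hP : IsSylowIn 3 P (Subgroup.centralizer {d}))
    (E : Subgroup H) (hEP : E ≤ P) (hEcard : Nat.card E = 27)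
    (hEab : ∀ a ∈ E, ∀ b ∈ E, a * b = b * a) (hEexp : ∀ a ∈ E, a ^ 3 = 1)
    (hsig : ∀ Y : Subgroup H, (Nat.card Y).Coprime 3 →
      (∀ e ∈ E, ∀ y ∈ Y, e⁻¹ * y * e ∈ Y) → Y = ⊥)
    (hnc : ¬ ∃ h : H, h⁻¹ * d * h = d⁻¹)
    (hidx : ∃ N : Subgroup H, N.Normal ∧ N.index = 3) :
    Subgroup.centralizer {d} = (⊤ : Subgroup H) := by
  obtain ⟨z, hz1, hz, ⟨e⟩⟩ := hX
  obtain ⟨f⟩ := equiv_centralizer z hz1 hz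
  obtain ⟨N, hN, hNi⟩ := hidx
  let ι₀ : X0 →* H := (Subgroup.centralizer {d}).subtype.comp (f.trans e.symm).toMonoidHom
  have hinj₀ : Function.Injective ι₀ :=
    (Subtype.val_injective).comp (f.trans e.symm).injective
  have hran : ∀ g : H, g * d = d * g ↔ ∃ p, ι₀ p = g := by
    intro g
    constructor
    · intro hg
      refine ⟨(f.trans e.symm).symm ⟨g, mem_centralizer_singleton_iff.2 hg⟩, ?_⟩
      change (((f.trans e.symm) ((f.trans e.symm).symm _) : Subgroup.centralizer {d}) : H) = g
      rw [MulEquiv.apply_symm_apply]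
    · rintro ⟨p, rfl⟩
      exact mem_centralizer_singleton_iff.1 ((f.trans e.symm) p).2
  have hd1 : d ≠ 1 := by
    rintro rfl
    simp at hd
  have hdd : d = ι₀ d0 ∨ d = (ι₀ d0)⁻¹ := by
    obtain ⟨p, hp⟩ := (hran d).1 rfl
    have hcp : ∀ q, p * q = q * p := by
      intro q
      apply hinj₀
      rw [map_mul, map_mul, hp]
      exact ((hran _).2 ⟨q, rfl⟩).symm
    have hq := comm_ab p (hcp _) (hcp _)
    have hs : p.s = 0 ∨ p.s = 1 ∨ p.s = -1 := by generalize p.s = s; revert s; decide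
    rw [← hp] at hd1 ⊢
    rcases hs with hs | hs | hs
    · exfalso
      rw [hs] at hq
      have h1 : p = 1 := hq
      exact hd1 (by rw [h1, map_one])
    · left; rw [hq, hs]; rfl
    · right; rw [hq, hs, ← map_inv]; congr 1
  have hcomm : ∀ g : H, g * ι₀ d0 = ι₀ d0 * g ↔ g * d = d * g := by
    intro g
    rcases hdd with h | h
    · rw [h]
    · rw [h, comm_inv_iff]
  have hEmap : (E.comap ι₀).map ι₀ = E := by
    apply Subgroup.map_comap_eq_self
    intro x hx
    obtain ⟨p, hp⟩ := (hran x).1 (mem_centralizer_singleton_iff.1 (hP.1 (hEP hx)))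
    exact ⟨p, hp⟩
  have hRc : Nat.card (E.comap ι₀) = 27 := by
    rw [← Subgroup.card_map_of_injective hinj₀, hEmap, hEcard]
  obtain ⟨g, hg⟩ := exists_conj_E0 (E.comap ι₀) hRc (by
    intro a ha b hb
    apply hinj₀
    rw [map_mul, map_mul]
    exact hEab _ ha _ hb)
  let ι : X0 →* H := ι₀.comp (MulAut.conj g⁻¹).toMonoidHom
  have hι : ∀ p, ι p = ι₀ (g⁻¹ * p * g) := fun p => by
    change ι₀ (g⁻¹ * p * g⁻¹⁻¹) = _
    rw [inv_inv]
  have hιd : ι d0 = ι₀ d0 := by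
    rw [hι, mul_assoc, ← d0_comm, inv_mul_cancel_left]
  have cfg : Cfg ι N :=
    { inj := hinj₀.comp (MulAut.conj g⁻¹).injective
      cent := by
        intro x hx
        rw [hιd, hcomm, hran] at hx
        obtain ⟨p, rfl⟩ := hx
        refine ⟨g * p * g⁻¹, ?_⟩
        rw [hι]
        congr 1
        group
      nc := by
        intro x hx
        rw [hιd] at hx
        apply hnc
        refine ⟨x⁻¹, ?_⟩
        rw [inv_inv]
        rcases hdd with h | h
        · rw [h]; exact hx
        · rw [h, inv_inv]
          have := congrArg Inv.inv hx
          rw [inv_inv] at this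
          refine Eq.trans ?_ this
          group
      sig := by
        intro Y hY hn
        apply hsig Y hY
        intro x hx y hy
        rw [← hEmap] at hx
        obtain ⟨r, hr, rfl⟩ := hx
        have h1 := hn (g * r⁻¹ * g⁻¹) (hg _ (inv_mem hr)) y hy
        have h2 : ι (g * r⁻¹ * g⁻¹) = (ι₀ r)⁻¹ := by
          rw [hι, ← map_inv]
          congr 1
          group
        rw [h2, inv_inv] at h1
        exact h1
      knorm := hN
      kidx := hNi }
  rw [eq_top_iff]
  intro x _
  rw [mem_centralizer_singleton_iff, ← hcomm, ← hιd]
  exact cfg.final x
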